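/- Let $c\ge 1$ be an integer and let $1\le p\le\infty$. Let $g:\mathbb Z^c\to(0,+\infty)$ be a weight such that (a) $g(0)=1$, (b) $g(m+n)\le g(m)g(n)$, (c) $g(-n)=g(n)$, (d) $g(n)\ge 1$ for all $m,n\in\mathbb Z^c$, and (e) $\lim_{n\to\infty} g(nt)^{1/n}=1$ for every $t\in\mathbb Z^c$. A bounded operator $b$ on a Banach space $X$ is nuclear if $bx=\sum_{i=1}^\infty a_i(x)y_i$ for all $x\in X$, with $a_i\in X^*$, $y_i\in X$ and $\sum_i\|a_i\|\,\|y_i\|<\infty$; its nuclear norm $\|b\|_{\mathfrak S_1}$ is the infimum of $\sum_i\|a_i\|\,\|y_i\|$ over all such representations. Let $\varphi:L_p(\mathbb R^c,\mathbb C)\to l_p(\mathbb Z^c,L_p([0,1)^c,\mathbb C))$ be the isometric isomorphism $\varphi(x)=(x_m)_{m\in\mathbb Z^c}$, $x_m(t)=x(t+m)$ for $t\in[0,1)^c$. An operator $A\in B(L_p(\mathbb R^c,\mathbb C))$ is called locally nuclear (it belongs to the class $S_{1,g}(\mathbb R^c,\mathfrak S_1)$) if $T=\varphi A\varphi^{-1}$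 has the form $(Tz)_k=\sum_{m\in\mathbb Z^c}b_{km}z_{k-m}$, $k\in\mathbb Z^c$, where all $b_{km}$ are nuclear operators on $L_p([0,1)^c,\mathbb C)$ and $\|b_{km}\|_{\mathfrak S_1}\le\beta_m$ for some family $\beta=(\beta_m)_{m\in\mathbb Z^c}$ with $\sum_m g(m)|\beta_m|<\infty$. Let $A\in B(L_p(\mathbb R^c,\mathbb C))$ be locally nuclear, and let $\lambda\in\mathbb C$ be such that $\lambda\mathbf 1+A$ is invertible in $B(L_p(\mathbb R^c,\mathbb C))$. Then $\lambda\ne 0$ and $(\lambda\mathbf 1+A)^{-1}=\lambda^{-1}\mathbf 1+A_1$, where $A_1$ is again locally nuclear. Moreover, the set $\{\alpha\mathbf 1+A:\alpha\in\mathbb C,\ A\in S_{1,g}(\mathbb R^c,\mathfrak S_1)\}$ is a full subalgebra of $B(L_p(\mathbb R^c,\mathbb C))$, that is, a unital subalgebra which contains the inverse of each of its elements that is invertible in $B(L_p(\mathbb R^c,\mathbb C))$. -/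

import Mathlib

open MeasureTheory
open scoped ENNReal Topology

/-- A weight on `ℤ^c` with the standing properties (a)-(e). -/
structure IsAdmissibleWeight {c : ℕ} (g : (Fin c → ℤ) → ℝ) : Prop where
  pos : ∀ n, 0 < g n
  map_zero : g 0 = 1
  submul : ∀ m n, g (m + n) ≤ g m * g n
  symm : ∀ n, g (-n) = g n
  one_le : ∀ n, 1 ≤ g n
  grs : ∀ t : Fin c → ℤ,
    Filter.Tendsto (fun n : ℕ => (g ((n : ℤ) • t)) ^ ((n : ℝ)⁻¹)) Filter.atTop (𝓝 1)

/-- `A` has the nuclear representation `Ax = ∑ i, a i x • y i` with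
`∑ i, ‖a i‖ * ‖y i‖ < ∞`. -/
def NuclearRep {X : Type*} [NormedAddCommGroup X] [NormedSpace ℂ X]
    (A : X →L[ℂ] X) (a : ℕ → (X →L[ℂ] ℂ)) (y : ℕ → X) : Prop :=
  Summable (fun i => ‖a i‖ * ‖y i‖) ∧ ∀ x : X, HasSum (fun i => a i x • y i) (A x)

/-- A bounded linear operator is nuclear if it admits a nuclear representation. -/
def IsNuclear {X : Type*} [NormedAddCommGroup X] [NormedSpace ℂ X]
    (A : X →L[ℂ] X) : Prop :=
  ∃ a y, NuclearRep A a y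

/-- The nuclear norm `‖A‖_{𝔖₁}` (meaningful for nuclear `A`). -/
noncomputable def nuclearNorm {X : Type*} [NormedAddCommGroup X] [NormedSpace ℂ X]
    (A : X →L[ℂ] X) : ℝ :=
  sInf {r | ∃ a y, NuclearRep A a y ∧ r = ∑' i, ‖a i‖ * ‖y i‖}

/-- The class `s_{1,g}(ℤ^c, 𝔖₁(X))` of locally nuclear operators on `l_p(ℤ^c, X)`. -/
def IsLocallyNuclear {c : ℕ} {p : ℝ≥0∞} [Fact (1 ≤ p)] {X : Type*}
    [NormedAddCommGroup X] [NormedSpace ℂ X] (g : (Fin c → ℤ) → ℝ)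
    (T : lp (fun _ : Fin c → ℤ => X) p →L[ℂ] lp (fun _ : Fin c → ℤ => X) p) : Prop :=
  ∃ (b : (Fin c → ℤ) → (Fin c → ℤ) → (X →L[ℂ] X)) (β : (Fin c → ℤ) → ℝ),
    (Summable fun m => g m * |β m|) ∧
    (∀ k m, IsNuclear (b k m)) ∧ (∀ k m, nuclearNorm (b k m) ≤ β m) ∧
    (∀ x k, HasSum (fun m => b k m (x (k - m))) (T x k))

/-- The unit cube `[0,1)^c` in `ℝ^c`. -/
def unitCube (c : ℕ) : Set (Fin c → ℝ) := Set.univ.pi fun _ => Set.Ico (0 : ℝ) 1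

/-- Lebesgue measure on `[0,1)^c`. -/
noncomputable abbrev cubeMeasure (c : ℕ) : Measure (Fin c → ℝ) :=
  (volume : Measure (Fin c → ℝ)).restrict (unitCube c)

/-- `L_p(ℝ^c, ℂ)`. -/
abbrev LpSpace (c : ℕ) (p : ℝ≥0∞) : Type :=
  Lp ℂ p (volume : Measure (Fin c → ℝ))

/-- `L_p([0,1)^c, ℂ)`. -/
abbrev LpCube (c : ℕ) (p : ℝ≥0∞) : Type :=
  Lp ℂ p (cubeMeasure c)

/-- `l_p(ℤ^c, L_p([0,1)^c, ℂ))`. -/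
abbrev SeqLpCube (c : ℕ) (p : ℝ≥0∞) [Fact (1 ≤ p)] : Type :=
  lp (fun _ : Fin c → ℤ => LpCube c p) p

/-- The inclusion `ℤ^c → ℝ^c`. -/
def latticePt {c : ℕ} (m : Fin c → ℤ) : Fin c → ℝ := fun i => (m i : ℝ)

/-- The coordinatewise integer part `ℝ^c → ℤ^c`. -/
noncomputable def floorPt {c : ℕ} (s : Fin c → ℝ) : Fin c → ℤ := fun i => ⌊s i⌋

theorem measurableSet_unitCube (c : ℕ) : MeasurableSet (unitCube c) :=
  MeasurableSet.univ_pi fun _ => measurableSet_Ico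

theorem sub_latticePt_mem_unitCube {c : ℕ} {s : Fin c → ℝ} {m : Fin c → ℤ} :
    s - latticePt m ∈ unitCube c ↔ floorPt s = m := by
  simp only [unitCube, latticePt, floorPt, Set.mem_univ_pi, Pi.sub_apply, Set.mem_Ico, funext_iff,
    Int.floor_eq_iff]
  refine forall_congr' fun i => ?_
  constructor <;> rintro ⟨h1, h2⟩ <;> constructor <;> linarith

theorem floorPt_add_latticePt {c : ℕ} {t : Fin c → ℝ} (ht : t ∈ unitCube c) (m : Fin c → ℤ) :
    floorPt (t + latticePt m) = m := by
  rw [← sub_latticePt_mem_unitCube]; simpa using ht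

theorem measurable_floorPt (c : ℕ) : Measurable (floorPt (c := c)) :=
  measurable_pi_lambda _ fun i => Int.measurable_floor.comp (measurable_pi_apply i)

theorem ae_of_ae_cube {c : ℕ} {P : (Fin c → ℝ) → Prop}
    (h : ∀ m : Fin c → ℤ, ∀ᵐ t ∂(cubeMeasure c), P (t + latticePt m)) :
    ∀ᵐ s ∂(volume : Measure (Fin c → ℝ)), P s := by
  have h' : ∀ m : Fin c → ℤ, ∀ᵐ s ∂(volume : Measure (Fin c → ℝ)),
      s - latticePt m ∈ unitCube c → P s := by
    intro m
    have h1 := (ae_restrict_iff' (measurableSet_unitCube c)).1 (h m)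
    have h2 := (measurePreserving_sub_right (volume : Measure (Fin c → ℝ))
      (latticePt m)).quasiMeasurePreserving.ae h1
    filter_upwards [h2] with s hs hm
    simpa using hs hm
  filter_upwards [ae_all_iff.2 h'] with s hs
  exact hs (floorPt s) (sub_latticePt_mem_unitCube.2 rfl)

theorem ae_cube_of_ae {c : ℕ} {P : (Fin c → ℝ) → Prop}
    (h : ∀ᵐ s ∂(volume : Measure (Fin c → ℝ)), P s) (m : Fin c → ℤ) :
    ∀ᵐ t ∂(cubeMeasure c), P (t + latticePt m) :=
  ae_restrict_of_ae
    ((measurePreserving_add_right volume (latticePt m)).quasiMeasurePreserving.ae h)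

theorem lintegral_eq_tsum_cube {c : ℕ} (f : (Fin c → ℝ) → ℝ≥0∞) :
    ∫⁻ s, f s = ∑' m : Fin c → ℤ, ∫⁻ t, f (t + latticePt m) ∂(cubeMeasure c) := by
  have hU : (⋃ m : Fin c → ℤ, (fun s => s - latticePt m) ⁻¹' unitCube c) = Set.univ :=
    Set.eq_univ_of_forall fun s => Set.mem_iUnion.2 ⟨floorPt s, sub_latticePt_mem_unitCube.2 rfl⟩
  have hd : Pairwise (Function.onFun Disjoint
      fun m : Fin c → ℤ => (fun s : Fin c → ℝ => s - latticePt m) ⁻¹' unitCube c) := by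
    intro m n hmn
    refine Set.disjoint_left.2 fun s hm hn => hmn ?_
    exact (sub_latticePt_mem_unitCube.1 hm).symm.trans (sub_latticePt_mem_unitCube.1 hn)
  rw [← setLIntegral_univ, ← hU, lintegral_iUnion
    (fun m => (measurable_sub_const (latticePt m)) (measurableSet_unitCube c)) hd]
  refine tsum_congr fun m => ?_
  have := (measurePreserving_sub_right (volume : Measure (Fin c → ℝ))
    (latticePt m)).setLIntegral_comp_preimage_emb
    (MeasurableEquiv.subRight (latticePt m)).measurableEmbedding
    (fun t => f (t + latticePt m)) (unitCube c)
  simpa using this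

theorem eLpNorm_rpow_eq_tsum_cube {c : ℕ} {p : ℝ≥0∞} (h0 : p ≠ 0) (h1 : p ≠ ∞)
    (f : (Fin c → ℝ) → ℂ) :
    eLpNorm f p volume ^ p.toReal =
      ∑' m : Fin c → ℤ,
        eLpNorm (fun t => f (t + latticePt m)) p (cubeMeasure c) ^ p.toReal := by
  have hp : p.toReal ≠ 0 := (ENNReal.toReal_pos h0 h1).ne'
  simp only [eLpNorm_eq_lintegral_rpow_enorm_toReal h0 h1, ← ENNReal.rpow_mul, one_div,
    inv_mul_cancel₀ hp, ENNReal.rpow_one]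
  exact lintegral_eq_tsum_cube _

theorem eLpNorm_top_le_of_ae_bound_cube {c : ℕ} {f : (Fin c → ℝ) → ℂ} {C : ℝ}
    (h : ∀ m : Fin c → ℤ, ∀ᵐ t ∂(cubeMeasure c), ‖f (t + latticePt m)‖ ≤ C) :
    eLpNorm f ∞ volume ≤ ENNReal.ofReal C := by
  rw [eLpNorm_exponent_top]
  exact eLpNormEssSup_le_of_ae_bound (ae_of_ae_cube (P := fun s => ‖f s‖ ≤ C) h)

theorem ae_norm_le_norm_Lp_top {c : ℕ} (y : LpCube c ∞) :
    ∀ᵐ t ∂(cubeMeasure c), ‖y t‖ ≤ ‖y‖ := by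
  filter_upwards [enorm_ae_le_eLpNormEssSup y (cubeMeasure c)] with t ht
  rw [Lp.norm_def, eLpNorm_exponent_top, ← toReal_enorm]
  refine ENNReal.toReal_mono ?_ ht
  have := Lp.eLpNorm_ne_top y
  rwa [eLpNorm_exponent_top] at this

theorem memLp_cubePiece {c : ℕ} {p : ℝ≥0∞} (x : LpSpace c p) (m : Fin c → ℤ) :
    MemLp (fun t => x (t + latticePt m)) p (cubeMeasure c) :=
  ((Lp.memLp x).comp_measurePreserving
    (measurePreserving_add_right volume (latticePt m))).restrict _

/-- The piece `x_m(t) = x(t + m)`, `t ∈ [0,1)^c`, of `x ∈ L_p(ℝ^c, ℂ)`. -/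
noncomputable def cubePiece {c : ℕ} {p : ℝ≥0∞} (x : LpSpace c p) (m : Fin c → ℤ) :
    LpCube c p :=
  (memLp_cubePiece x m).toLp _

theorem coeFn_cubePiece {c : ℕ} {p : ℝ≥0∞} (x : LpSpace c p) (m : Fin c → ℤ) :
    cubePiece x m =ᵐ[cubeMeasure c] fun t => x (t + latticePt m) :=
  MemLp.coeFn_toLp _

theorem norm_cubePiece {c : ℕ} {p : ℝ≥0∞} (x : LpSpace c p) (m : Fin c → ℤ) :
    ‖cubePiece x m‖ = (eLpNorm (fun t => x (t + latticePt m)) p (cubeMeasure c)).toReal :=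
  Lp.norm_toLp _ _

theorem norm_cubePiece_le {c : ℕ} {p : ℝ≥0∞} (x : LpSpace c p) (m : Fin c → ℤ) :
    ‖cubePiece x m‖ ≤ ‖x‖ := by
  rw [norm_cubePiece, Lp.norm_def]
  refine ENNReal.toReal_mono (Lp.eLpNorm_ne_top x) ?_
  refine (eLpNorm_mono_measure _ Measure.restrict_le_self).trans ?_
  exact (eLpNorm_comp_measurePreserving (Lp.aestronglyMeasurable x)
    (measurePreserving_add_right volume (latticePt m))).le

theorem memℓp_cubePiece {c : ℕ} {p : ℝ≥0∞} [hp : Fact (1 ≤ p)] (x : LpSpace c p) :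
    Memℓp (fun m : Fin c → ℤ => cubePiece x m) p := by
  have h0 : p ≠ 0 := (zero_lt_one.trans_le hp.out).ne'
  rcases eq_or_ne p ∞ with rfl | h1
  · exact memℓp_infty ⟨‖x‖, by rintro _ ⟨m, rfl⟩; exact norm_cubePiece_le x m⟩
  · refine memℓp_gen ?_
    simp only [norm_cubePiece, ENNReal.toReal_rpow]
    refine ENNReal.summable_toReal ?_
    rw [← eLpNorm_rpow_eq_tsum_cube h0 h1]
    exact ENNReal.rpow_ne_top_of_nonneg ENNReal.toReal_nonneg (Lp.eLpNorm_ne_top x)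

/-- The linear isometry `x ↦ (x_m)_{m ∈ ℤ^c}`, `x_m(t) = x(t + m)`. -/
noncomputable def cubeIsometry (c : ℕ) (p : ℝ≥0∞) [hp : Fact (1 ≤ p)] :
    LpSpace c p →ₗᵢ[ℂ] SeqLpCube c p where
  toFun x := ⟨fun m => cubePiece x m, memℓp_cubePiece x⟩
  map_add' x y := by
    ext m : 2
    refine Lp.ext ?_
    change cubePiece (x + y) m =ᵐ[_] (cubePiece x m + cubePiece y m : LpCube c p)
    filter_upwards [coeFn_cubePiece (x + y) m, coeFn_cubePiece x m, coeFn_cubePiece y m,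
      Lp.coeFn_add (cubePiece x m) (cubePiece y m), ae_cube_of_ae (Lp.coeFn_add x y) m]
      with t h1 h2 h3 h4 h5
    rw [h1, h4, Pi.add_apply, h2, h3, h5, Pi.add_apply]
  map_smul' a x := by
    ext m : 2
    refine Lp.ext ?_
    change cubePiece (a • x) m =ᵐ[_] (a • cubePiece x m : LpCube c p)
    filter_upwards [coeFn_cubePiece (a • x) m, coeFn_cubePiece x m,
      Lp.coeFn_smul a (cubePiece x m), ae_cube_of_ae (Lp.coeFn_smul a x) m]
      with t h1 h2 h3 h4
    rw [h1, h3, Pi.smul_apply, h2, h4, Pi.smul_apply]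
  norm_map' x := by
    change ‖(⟨fun m => cubePiece x m, memℓp_cubePiece x⟩ : SeqLpCube c p)‖ = ‖x‖
    have h0 : p ≠ 0 := (zero_lt_one.trans_le hp.out).ne'
    rcases eq_or_ne p ∞ with rfl | h1
    · refine le_antisymm
        (lp.norm_le_of_forall_le (norm_nonneg _) fun m => norm_cubePiece_le x m) ?_
      rw [Lp.norm_def]
      refine ENNReal.toReal_le_of_le_ofReal (norm_nonneg _) ?_
      refine eLpNorm_top_le_of_ae_bound_cube fun m => ?_
      filter_upwards [coeFn_cubePiece x m, ae_norm_le_norm_Lp_top (cubePiece x m)] with t h1 h2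
      rw [← h1]
      exact h2.trans (lp.norm_apply_le_norm ENNReal.top_ne_zero
        (⟨fun m => cubePiece x m, memℓp_cubePiece x⟩ : SeqLpCube c ∞) m)
    · have hpos : 0 < p.toReal := ENNReal.toReal_pos h0 h1
      refine (Real.rpow_left_inj (norm_nonneg _) (norm_nonneg _) hpos.ne').1 ?_
      rw [lp.norm_rpow_eq_tsum hpos, Lp.norm_def, ENNReal.toReal_rpow,
        eLpNorm_rpow_eq_tsum_cube h0 h1, ENNReal.tsum_toReal_eq fun m =>
          ENNReal.rpow_ne_top_of_nonneg ENNReal.toReal_nonneg (memLp_cubePiece x m).2.ne]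
      refine tsum_congr fun m => ?_
      change ‖cubePiece x m‖ ^ p.toReal = _
      rw [norm_cubePiece, ENNReal.toReal_rpow]

theorem cubeIsometry_surjective (c : ℕ) (p : ℝ≥0∞) [hp : Fact (1 ≤ p)] :
    Function.Surjective (cubeIsometry c p) := by
  intro z
  have h0 : p ≠ 0 := (zero_lt_one.trans_le hp.out).ne'
  set f : (Fin c → ℝ) → ℂ := fun s => z (floorPt s) (s - latticePt (floorPt s)) with hf
  have hfm : Measurable f := by
    have h : Measurable (fun q : (Fin c → ℤ) × (Fin c → ℝ) => z q.1 (q.2 - latticePt q.1)) :=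
      measurable_from_prod_countable_right fun m =>
        (Lp.stronglyMeasurable (z m)).measurable.comp (measurable_sub_const (latticePt m))
    exact h.comp ((measurable_floorPt c).prodMk measurable_id)
  have hfz : ∀ m : Fin c → ℤ, (fun t => f (t + latticePt m)) =ᵐ[cubeMeasure c] z m := by
    intro m
    filter_upwards [ae_restrict_mem (measurableSet_unitCube c)] with t ht
    simp only [hf, floorPt_add_latticePt ht, add_sub_cancel_right]
  have hfp : MemLp f p volume := by
    refine ⟨hfm.aestronglyMeasurable, ?_⟩
    rcases eq_or_ne p ∞ with rfl | h1
    · refine (eLpNorm_top_le_of_ae_bound_cube (C := ‖z‖) fun m => ?_).trans_lt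
        ENNReal.ofReal_lt_top
      filter_upwards [hfz m, ae_norm_le_norm_Lp_top (z m)] with t h1 h2
      rw [h1]
      exact h2.trans (lp.norm_apply_le_norm ENNReal.top_ne_zero z m)
    · have hpos : 0 < p.toReal := ENNReal.toReal_pos h0 h1
      refine (ENNReal.rpow_lt_top_iff_of_pos hpos).1 ?_
      rw [eLpNorm_rpow_eq_tsum_cube h0 h1]
      have hs := (lp.hasSum_norm hpos z).summable
      have he : ∀ m : Fin c → ℤ,
          eLpNorm (fun t => f (t + latticePt m)) p (cubeMeasure c) ^ p.toReal =
            ENNReal.ofReal (‖z m‖ ^ p.toReal) := by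
        intro m
        rw [eLpNorm_congr_ae (hfz m), Lp.norm_def, ENNReal.toReal_rpow, ENNReal.ofReal_toReal]
        exact ENNReal.rpow_ne_top_of_nonneg ENNReal.toReal_nonneg (Lp.eLpNorm_ne_top (z m))
      simp only [he]
      exact hs.tsum_ofReal_lt_top
  refine ⟨hfp.toLp f, ?_⟩
  ext m : 2
  refine Lp.ext ?_
  change cubePiece (hfp.toLp f) m =ᵐ[_] z m
  refine (coeFn_cubePiece _ m).trans (Filter.EventuallyEq.trans ?_ (hfz m))
  exact ae_cube_of_ae hfp.coeFn_toLp m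

/-- The isometric isomorphism `φ : L_p(ℝ^c, ℂ) → l_p(ℤ^c, L_p([0,1)^c, ℂ))`,
`φ(x) = (x_m)`, `x_m(t) = x(t + m)` for `t ∈ [0,1)^c`. -/
noncomputable def cubeEquiv (c : ℕ) (p : ℝ≥0∞) [Fact (1 ≤ p)] :
    LpSpace c p ≃ₗᵢ[ℂ] SeqLpCube c p :=
  LinearIsometryEquiv.ofSurjective (cubeIsometry c p) (cubeIsometry_surjective c p)

theorem coeFn_cubeEquiv {c : ℕ} {p : ℝ≥0∞} [Fact (1 ≤ p)] (x : LpSpace c p) (m : Fin c → ℤ) :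
    cubeEquiv c p x m =ᵐ[cubeMeasure c] fun t => x (t + latticePt m) :=
  coeFn_cubePiece x m

/-- The class `S_{1,g}(ℝ^c, 𝔖₁)`: `A ∈ B(L_p(ℝ^c, ℂ))` is locally nuclear if `φ A φ⁻¹` is. -/
def IsLocallyNuclearLp {c : ℕ} {p : ℝ≥0∞} [Fact (1 ≤ p)] (g : (Fin c → ℤ) → ℝ)
    (A : LpSpace c p →L[ℂ] LpSpace c p) : Prop :=
  IsLocallyNuclear g
    ((cubeEquiv c p : LpSpace c p →L[ℂ] SeqLpCube c p) ∘L A ∘L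
      ((cubeEquiv c p).symm : SeqLpCube c p →L[ℂ] LpSpace c p))

/-- The set `{α • 1 + A : α ∈ ℂ, A ∈ S}`, obtained from `S` by adjoining the unit. -/
def adjoinUnit {𝔅 : Type*} [Ring 𝔅] [Algebra ℂ 𝔅] (S : Set 𝔅) : Set 𝔅 :=
  {B | ∃ (α : ℂ) (A : 𝔅), A ∈ S ∧ B = α • (1 : 𝔅) + A}

/-- `S` is (the underlying set of) a full, i.e. inverse-closed, unital subalgebra of `𝔅`. -/
def IsFullSubalgebra {𝔅 : Type*} [Ring 𝔅] [Algebra ℂ 𝔅] (S : Set 𝔅) : Prop :=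
  ∃ R : Subalgebra ℂ 𝔅, (R : Set 𝔅) = S ∧
    ∀ B ∈ R, ∀ Q : 𝔅, B * Q = 1 → Q * B = 1 → Q ∈ R

section DiagonalOperators

variable {G : Type*} [AddCommGroup G] {X : Type*} [NormedAddCommGroup X] {p : ℝ≥0∞}

theorem memℓp_translate {x : G → X} (hx : Memℓp x p) (m : G) :
    Memℓp (fun k => x (k - m)) p := by
  obtain rfl | rfl | hp := p.trichotomy
  · rw [memℓp_zero_iff] at hx ⊢
    exact hx.preimage (sub_left_injective.injOn)
  · rw [memℓp_infty_iff] at hx ⊢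
    exact hx.mono (by rintro _ ⟨k, rfl⟩; exact ⟨k - m, rfl⟩)
  · rw [memℓp_gen_iff hp] at hx ⊢
    exact (Equiv.subRight m).summable_iff.2 hx

theorem lp_norm_translate_le [Fact (1 ≤ p)] (x : lp (fun _ : G => X) p) (m : G) :
    ‖(⟨fun k => x (k - m), memℓp_translate (lp.memℓp x) m⟩ : lp (fun _ : G => X) p)‖ ≤ ‖x‖ := by
  have h0 : p ≠ 0 := (zero_lt_one.trans_le Fact.out).ne'
  obtain rfl | rfl | hp := p.trichotomy
  · exact absurd rfl h0
  · exact lp.norm_le_of_forall_le (norm_nonneg _) fun k => lp.norm_apply_le_norm h0 x (k - m)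
  · refine lp.norm_le_of_tsum_le hp (norm_nonneg _) (le_of_eq ?_)
    rw [lp.norm_rpow_eq_tsum hp]
    exact (Equiv.subRight m).tsum_eq fun k => ‖x k‖ ^ p.toReal

variable [NormedSpace ℂ X]

theorem memℓp_diagonal {d : G → X →L[ℂ] X} {C : ℝ} (hd : ∀ k, ‖d k‖ ≤ C) (m : G)
    {x : G → X} (hx : Memℓp x p) : Memℓp (fun k => d k (x (k - m))) p := by
  refine Memℓp.mono' ((memℓp_translate hx m).const_smul (C : ℂ)) fun k => ?_
  have hC : 0 ≤ C := (norm_nonneg _).trans (hd k)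
  simpa [norm_smul, abs_of_nonneg hC] using (d k).le_of_opNorm_le (hd k) (x (k - m))

/-- The operator on `l_p(G, X)` whose matrix is concentrated on the `m`-th diagonal:
`(D x)_k = d_k x_{k-m}`. -/
noncomputable def diagonalOp [Fact (1 ≤ p)] (d : G → X →L[ℂ] X) (C : ℝ) (hd : ∀ k, ‖d k‖ ≤ C)
    (m : G) : lp (fun _ : G => X) p →L[ℂ] lp (fun _ : G => X) p :=
  LinearMap.mkContinuous
    { toFun := fun x => ⟨fun k => d k (x (k - m)), memℓp_diagonal hd m (lp.memℓp x)⟩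
      map_add' := fun x y => by
        ext k : 2
        exact map_add (d k) (x (k - m)) (y (k - m))
      map_smul' := fun a x => by
        ext k : 2
        exact map_smul (d k) a (x (k - m)) } C fun x => by
    have hC : 0 ≤ C := (norm_nonneg _).trans (hd 0)
    have h0 : p ≠ 0 := (zero_lt_one.trans_le Fact.out).ne'
    have h := lp.norm_mono h0
      (x := (⟨fun k => d k (x (k - m)), memℓp_diagonal hd m (lp.memℓp x)⟩ :
        lp (fun _ : G => X) p))
      (y := (C : ℂ) • (⟨fun k => x (k - m), memℓp_translate (lp.memℓp x) m⟩ :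
        lp (fun _ : G => X) p)) fun k => by
          change ‖d k (x (k - m))‖ ≤ ‖(C : ℂ) • x (k - m)‖
          rw [norm_smul, Complex.norm_of_nonneg hC]
          exact (d k).le_of_opNorm_le (hd k) (x (k - m))
    refine h.trans ?_
    rw [norm_smul, Complex.norm_of_nonneg hC]
    exact mul_le_mul_of_nonneg_left (lp_norm_translate_le x m) hC

@[simp]
theorem diagonalOp_apply [Fact (1 ≤ p)] (d : G → X →L[ℂ] X) (C : ℝ) (hd : ∀ k, ‖d k‖ ≤ C) (m : G)
    (x : lp (fun _ : G => X) p) (k : G) : diagonalOp d C hd m x k = d k (x (k - m)) :=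
  rfl

theorem norm_diagonalOp_le [Fact (1 ≤ p)] (d : G → X →L[ℂ] X) (C : ℝ) (hd : ∀ k, ‖d k‖ ≤ C)
    (m : G) : ‖(diagonalOp d C hd m : lp (fun _ : G => X) p →L[ℂ] lp (fun _ : G => X) p)‖ ≤ C :=
  LinearMap.mkContinuous_norm_le _ ((norm_nonneg _).trans (hd 0)) _

end DiagonalOperators

section MaximalLeftIdeals

variable {𝒜 : Type*} [NormedRing 𝒜] [NormedAlgebra ℂ 𝒜] [CompleteSpace 𝒜]

/-- The action of an element of a Banach algebra on the quotient by a closed left ideal. -/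
noncomputable def quotientSMul (L : Ideal 𝒜) [IsClosed (L : Set 𝒜)] (δ : 𝒜) :
    (𝒜 ⧸ L) →L[ℂ] (𝒜 ⧸ L) :=
  LinearMap.mkContinuous
    { toFun := fun x => δ • x
      map_add' := smul_add δ
      map_smul' := fun a x => by
        obtain ⟨y, rfl⟩ := Submodule.Quotient.mk_surjective L x
        simp only [← Submodule.Quotient.mk_smul, RingHom.id_apply, smul_eq_mul, mul_smul_comm] }
    ‖δ‖ fun x => by
      refine le_of_forall_pos_le_add fun ε hε => ?_
      have hδ : 0 < ‖δ‖ + 1 := by positivity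
      obtain ⟨y, rfl, hy⟩ := Submodule.Quotient.norm_mk_lt x (div_pos hε hδ)
      calc ‖(Submodule.Quotient.mk (δ * y) : 𝒜 ⧸ L)‖ ≤ ‖δ * y‖ :=
            Submodule.Quotient.norm_mk_le L _
        _ ≤ ‖δ‖ * ‖y‖ := norm_mul_le _ _
        _ ≤ ‖δ‖ * (‖(Submodule.Quotient.mk y : 𝒜 ⧸ L)‖ + ε / (‖δ‖ + 1)) := by gcongr
        _ = ‖δ‖ * ‖(Submodule.Quotient.mk y : 𝒜 ⧸ L)‖ + ε * (‖δ‖ / (‖δ‖ + 1)) := by ring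
        _ ≤ ‖δ‖ * ‖(Submodule.Quotient.mk y : 𝒜 ⧸ L)‖ + ε * 1 := by
            gcongr
            exact (div_le_one hδ).2 (by linarith)
        _ = _ := by rw [mul_one]

/-- A central element of a Banach algebra acts as a scalar modulo a maximal left ideal. -/
theorem exists_sub_algebraMap_mem_of_isMaximal (L : Ideal 𝒜) [hL : L.IsMaximal] {δ : 𝒜}
    (hδ : ∀ a, a * δ = δ * a) : ∃ z : ℂ, δ - algebraMap ℂ 𝒜 z ∈ L := by
  have hs : IsSimpleModule 𝒜 (𝒜 ⧸ L) := isSimpleModule_iff_isCoatom.2 hL.out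
  have hn : Nontrivial (𝒜 ⧸ L) := hs.nontrivial
  obtain ⟨z, hz⟩ := spectrum.nonempty (quotientSMul L δ)
  refine ⟨z, ?_⟩
  let f : (𝒜 ⧸ L) →ₗ[𝒜] (𝒜 ⧸ L) :=
    { toFun := fun x => (algebraMap ℂ 𝒜 z - δ) • x
      map_add' := smul_add _
      map_smul' := fun a x => by
        simp only [RingHom.id_apply, smul_smul]
        rw [sub_mul, mul_sub, hδ, Algebra.commutes] }
  have hf : ⇑f = ⇑(algebraMap ℂ ((𝒜 ⧸ L) →L[ℂ] (𝒜 ⧸ L)) z - quotientSMul L δ) := by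
    funext x
    obtain ⟨y, rfl⟩ := Submodule.Quotient.mk_surjective L x
    change (algebraMap ℂ 𝒜 z - δ) • (Submodule.Quotient.mk y : 𝒜 ⧸ L) =
      z • (Submodule.Quotient.mk y : 𝒜 ⧸ L) - δ • (Submodule.Quotient.mk y : 𝒜 ⧸ L)
    rw [sub_smul]
    congr 1
    rw [← Submodule.Quotient.mk_smul, ← Submodule.Quotient.mk_smul, smul_eq_mul,
      ← Algebra.smul_def]
  rcases f.bijective_or_eq_zero with h | h
  · rw [hf] at h
    exact absurd (ContinuousLinearMap.isUnit_iff_bijective.2 h) hz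
  · have h1 : f (Submodule.Quotient.mk 1) = 0 := by rw [h]; rfl
    have h2 : (Submodule.Quotient.mk ((algebraMap ℂ 𝒜 z - δ) * 1) : 𝒜 ⧸ L) = 0 := h1
    rw [Submodule.Quotient.mk_eq_zero, mul_one] at h2
    simpa using L.neg_mem h2

theorem norm_le_of_sub_algebraMap_mem (h1 : ‖(1 : 𝒜)‖ ≤ 1) (L : Ideal 𝒜) (hL : L ≠ ⊤) {δ : 𝒜}
    {z : ℂ} (hz : δ - algebraMap ℂ 𝒜 z ∈ L) : ‖z‖ ≤ ‖δ‖ := by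
  by_contra! h
  have h2 : ‖δ‖ * ‖(1 : 𝒜)‖ < ‖z‖ :=
    (mul_le_of_le_one_right (norm_nonneg _) h1).trans_lt h
  have h3 : IsUnit (algebraMap ℂ 𝒜 z - δ) := spectrum.mem_resolventSet_of_norm_lt_mul h2
  exact hL (L.eq_top_of_isUnit_mem (by simpa using L.neg_mem hz) h3)

/-- A family of central elements, indexed by `ℤ^c` and bounded by an admissible weight, acts
modulo a maximal left ideal as a unitary character of `ℤ^c`. -/
theorem exists_unitary_character_of_isMaximal {c : ℕ} {g : (Fin c → ℤ) → ℝ}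
    (hg : IsAdmissibleWeight g) (h1 : ‖(1 : 𝒜)‖ ≤ 1) {δ : (Fin c → ℤ) → 𝒜}
    (hδ : ∀ m a, a * δ m = δ m * a) (hδ0 : δ 0 = 1) (hδa : ∀ m n, δ (m + n) = δ m * δ n)
    (hδg : ∀ m, ‖δ m‖ ≤ g m) (L : Ideal 𝒜) [hL : L.IsMaximal] :
    ∃ χ : (Fin c → ℤ) → ℂ, χ 0 = 1 ∧ (∀ m n, χ (m + n) = χ m * χ n) ∧ (∀ m, ‖χ m‖ = 1) ∧
      ∀ m, δ m - algebraMap ℂ 𝒜 (χ m) ∈ L := by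
  choose χ hχ using fun m => exists_sub_algebraMap_mem_of_isMaximal L (hδ m)
  have huniq : ∀ {a : 𝒜} {z w : ℂ}, a - algebraMap ℂ 𝒜 z ∈ L → a - algebraMap ℂ 𝒜 w ∈ L →
      z = w := by
    intro a z w hz hw
    have h := L.sub_mem hw hz
    rw [sub_sub_sub_cancel_left, ← map_sub] at h
    by_contra hne
    exact hL.ne_top (L.eq_top_of_isUnit_mem h
      ((sub_ne_zero.2 hne).isUnit.map (algebraMap ℂ 𝒜)))
  have hχ0 : χ 0 = 1 := huniq (hχ 0) (by simp [hδ0])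
  have hχa : ∀ m n, χ (m + n) = χ m * χ n := by
    intro m n
    refine huniq (hχ (m + n)) ?_
    have h := L.add_mem (L.mul_mem_left (δ m) (hχ n))
      (L.mul_mem_left (algebraMap ℂ 𝒜 (χ n)) (hχ m))
    rw [hδa, map_mul]
    convert h using 1
    rw [mul_sub, mul_sub, ← Algebra.commutes (χ n) (δ m), ← map_mul, ← map_mul, mul_comm (χ n)]
    abel
  have hpow : ∀ (m : Fin c → ℤ) (n : ℕ), χ ((n : ℤ) • m) = χ m ^ n := by
    intro m n
    induction n with
    | zero => simp [hχ0]
    | succ n ih => rw [Nat.cast_succ, add_smul, one_smul, hχa, ih, pow_succ]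
  have hle : ∀ m, ‖χ m‖ ≤ 1 := by
    intro m
    refine ge_of_tendsto (hg.grs m) ?_
    filter_upwards [Filter.eventually_gt_atTop 0] with n hn
    have h2 : ‖χ m‖ ^ n ≤ g ((n : ℤ) • m) := by
      rw [← norm_pow, ← hpow]
      exact (norm_le_of_sub_algebraMap_mem h1 L hL.ne_top (hχ _)).trans (hδg _)
    calc ‖χ m‖ = (‖χ m‖ ^ n) ^ ((n : ℝ)⁻¹) :=
          (Real.pow_rpow_inv_natCast (norm_nonneg _) hn.ne').symm
      _ ≤ _ := Real.rpow_le_rpow (by positivity) h2 (by positivity)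
  refine ⟨χ, hχ0, hχa, fun m => le_antisymm (hle m) ?_, hχ⟩
  have h2 : ‖χ m‖ * ‖χ (-m)‖ = 1 := by rw [← norm_mul, ← hχa, add_neg_cancel, hχ0, norm_one]
  nlinarith [hle (-m), norm_nonneg (χ m)]

end MaximalLeftIdeals

theorem HasSum.clm_apply {ι E F : Type*} [NormedAddCommGroup E] [NormedSpace ℂ E]
    [NormedAddCommGroup F] [NormedSpace ℂ F] {T : ι → E →L[ℂ] F} {S : E →L[ℂ] F}
    (h : HasSum T S) (x : E) : HasSum (fun i => T i x) (S x) :=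
  (ContinuousLinearMap.apply ℂ F x).hasSum h

theorem HasSum.lp_apply {ι G X : Type*} [NormedAddCommGroup X] [NormedSpace ℂ X] {p : ℝ≥0∞}
    [Fact (1 ≤ p)] {f : ι → lp (fun _ : G => X) p} {s : lp (fun _ : G => X) p}
    (h : HasSum f s) (k : G) : HasSum (fun i => f i k) (s k) :=
  (lp.evalCLM ℂ (fun _ : G => X) p k).hasSum h

section Commutant

variable {c : ℕ} {g : (Fin c → ℤ) → ℝ} {𝔹 : Type*} [NormedRing 𝔹] [NormedAlgebra ℂ 𝔹]

/-- Let `𝔹` and a group `δ` of translations with `‖δ m‖ ≤ g m` be represented by commuting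
operators inside the commutant of `K ∋ δ m` in a Banach algebra `𝒞`. If `∑ a_m χ(m)` is left
invertible in `𝔹` for all unitary characters `χ`, then `∑ a_m δ_m` has a left inverse in the
commutant of `K`. -/
theorem exists_left_inverse_mem_centralizer [CompleteSpace 𝔹] (hg : IsAdmissibleWeight g)
    {𝒞 : Type*} [NormedRing 𝒞] [NormedAlgebra ℂ 𝒞] [CompleteSpace 𝒞] (h1 : ‖(1 : 𝒞)‖ ≤ 1)
    {K : Set 𝒞} {ℓ : 𝔹 →L[ℂ] 𝒞} {δ : (Fin c → ℤ) → 𝒞}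
    (hℓ1 : ℓ 1 = 1) (hℓm : ∀ r s, ℓ (r * s) = ℓ r * ℓ s)
    (hℓK : ∀ r, ℓ r ∈ Set.centralizer K)
    (hδ0 : δ 0 = 1) (hδa : ∀ m n, δ (m + n) = δ m * δ n) (hδg : ∀ m, ‖δ m‖ ≤ g m)
    (hδK : ∀ m, δ m ∈ K) (hδK' : ∀ m, δ m ∈ Set.centralizer K)
    (hℓn : ∀ r, ‖ℓ r‖ ≤ ‖r‖) {a : (Fin c → ℤ) → 𝔹} (ha : Summable fun m => g m * ‖a m‖)
    (hinv : ∀ χ : (Fin c → ℤ) → ℂ, χ 0 = 1 → (∀ m n, χ (m + n) = χ m * χ n) →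
      (∀ m, ‖χ m‖ = 1) → ∃ q, q * ∑' m, χ m • a m = 1) :
    ∃ B ∈ Set.centralizer K, ∃ S, HasSum (fun m => ℓ (a m) * δ m) S ∧ B * S = 1 := by
  have ha' : Summable fun m => ‖a m‖ := ha.of_nonneg_of_le (fun m => norm_nonneg _)
    fun m => le_mul_of_one_le_left (norm_nonneg _) (hg.one_le m)
  obtain ⟨S, hS⟩ : Summable fun m => ℓ (a m) * δ m := by
    refine Summable.of_norm_bounded ha fun m => (norm_mul_le _ _).trans ?_
    rw [mul_comm]
    exact mul_le_mul (hδg m) (hℓn _) (norm_nonneg _) (hg.pos m).le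
  let 𝒜 : Subalgebra ℂ 𝒞 := Subalgebra.centralizer ℂ K
  have hcl : IsClosed (𝒜 : Set 𝒞) := Set.isClosed_centralizer K
  have : CompleteSpace 𝒜 := hcl.completeSpace_coe
  have hSK : S ∈ 𝒜 := hcl.mem_of_tendsto hS (.of_forall fun s =>
    𝒜.sum_mem fun m _ => 𝒜.mul_mem (hℓK (a m)) (hδK' m))
  by_contra! hno
  have htop : Ideal.span {(⟨S, hSK⟩ : 𝒜)} ≠ ⊤ := by
    rw [Ne, Ideal.eq_top_iff_one, Ideal.mem_span_singleton']
    rintro ⟨B, hB⟩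
    exact hno B.1 B.2 S hS (congrArg Subtype.val hB)
  obtain ⟨L, hL, hSL⟩ := Ideal.exists_le_maximal _ htop
  obtain ⟨χ, h0, hadd, hnorm, hχ⟩ := exists_unitary_character_of_isMaximal hg
    (𝒜 := 𝒜) (δ := fun m => ⟨δ m, hδK' m⟩) h1
    (fun m B => Subtype.ext (B.2 (δ m) (hδK m)).symm) (Subtype.ext hδ0)
    (fun m n => Subtype.ext (hδa m n)) hδg L
  obtain ⟨q, hq⟩ := hinv χ h0 hadd hnorm
  have hsum : HasSum (fun m => χ m • a m) (∑' m, χ m • a m) :=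
    (Summable.of_norm_bounded ha' fun m => by rw [norm_smul, hnorm, one_mul]).hasSum
  have hdiff : HasSum (fun m => ℓ (a m) * (δ m - algebraMap ℂ 𝒞 (χ m)))
      (S - ℓ (∑' m, χ m • a m)) := by
    refine (hS.sub (ℓ.hasSum hsum)).congr_fun fun m => ?_
    rw [mul_sub, ← Algebra.commutes, ← Algebra.smul_def, map_smul]
  let ℓ' : 𝔹 → 𝒜 := fun r => ⟨ℓ r, hℓK r⟩
  have hdiff' : HasSum (fun m => ℓ' (a m) * (⟨δ m, hδK' m⟩ - algebraMap ℂ 𝒜 (χ m)))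
      (⟨S, hSK⟩ - ℓ' (∑' m, χ m • a m)) :=
    (Topology.IsInducing.hasSum_iff (g := 𝒜.val) Topology.IsInducing.subtypeVal _ _).1 hdiff
  have hmem : ⟨S, hSK⟩ - ℓ' (∑' m, χ m • a m) ∈ L :=
    (Ideal.IsMaximal.isClosed (I := L)).mem_of_tendsto hdiff' (.of_forall fun s =>
      L.sum_mem fun m _ => L.mul_mem_left _ (hχ m))
  have hmem' : ℓ' (∑' m, χ m • a m) ∈ L := by
    simpa using L.sub_mem (hSL (Ideal.mem_span_singleton_self _)) hmem
  refine hL.ne_top ((Ideal.eq_top_iff_one L).2 ?_)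
  have h2 : ℓ' q * ℓ' (∑' m, χ m • a m) = 1 :=
    Subtype.ext ((hℓm _ _).symm.trans ((congrArg ℓ hq).trans hℓ1))
  exact h2 ▸ L.mul_mem_left (ℓ' q) hmem'

end Commutant

section WeightedConvolution

variable {c : ℕ} {g : (Fin c → ℤ) → ℝ} {𝔹 : Type*} [NormedRing 𝔹] [NormedAlgebra ℂ 𝔹]

theorem IsAdmissibleWeight.div_sub_le (hg : IsAdmissibleWeight g) (k m : Fin c → ℤ) :
    g k / g (k - m) ≤ g m := by
  rw [div_le_iff₀ (hg.pos _)]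
  simpa using hg.submul m (k - m)

theorem IsAdmissibleWeight.norm_div_sub_smul_id_le (hg : IsAdmissibleWeight g)
    {Y : Type*} [NormedAddCommGroup Y] [NormedSpace ℂ Y]
    (k m : Fin c → ℤ) :
    ‖((g k / g (k - m) : ℝ) : ℂ) • ContinuousLinearMap.id ℂ Y‖ ≤ g m := by
  have h : 0 ≤ g k / g (k - m) := div_nonneg (hg.pos _).le (hg.pos _).le
  rw [norm_smul, Complex.norm_of_nonneg h]
  exact (mul_le_of_le_one_right h ContinuousLinearMap.norm_id_le).trans (hg.div_sub_le k m)

/-- Translation by `m` on the weighted space `l_{1,g}(ℤ^c, Y)`; an element `f` of this space is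
represented by the family `g(k) f_k` of `l_1(ℤ^c, Y)`. -/
noncomputable def weightedShift (Y : Type*) [NormedAddCommGroup Y] [NormedSpace ℂ Y]
    (hg : IsAdmissibleWeight g) (m : Fin c → ℤ) :
    lp (fun _ : Fin c → ℤ => Y) 1 →L[ℂ] lp (fun _ : Fin c → ℤ => Y) 1 :=
  diagonalOp (fun k => ((g k / g (k - m) : ℝ) : ℂ) • ContinuousLinearMap.id ℂ Y) (g m)
    (fun k => hg.norm_div_sub_smul_id_le k m) m

/-- Coefficientwise action of an operator. -/
noncomputable def coeffMap (c : ℕ) {Y : Type*} [NormedAddCommGroup Y] [NormedSpace ℂ Y]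
    (r : Y →L[ℂ] Y) :
    lp (fun _ : Fin c → ℤ => Y) 1 →L[ℂ] lp (fun _ : Fin c → ℤ => Y) 1 :=
  diagonalOp (fun _ => r) ‖r‖ (fun _ => le_rfl) 0

variable {Y : Type*} [NormedAddCommGroup Y] [NormedSpace ℂ Y]

theorem weightedShift_apply (hg : IsAdmissibleWeight g) (m k : Fin c → ℤ)
    (f : lp (fun _ : Fin c → ℤ => Y) 1) :
    weightedShift Y hg m f k = ((g k / g (k - m) : ℝ) : ℂ) • f (k - m) :=
  rfl

theorem coeffMap_apply (r : Y →L[ℂ] Y) (f : lp (fun _ : Fin c → ℤ => Y) 1) (k : Fin c → ℤ) :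
    coeffMap c r f k = r (f k) := by
  simp [coeffMap]

theorem weightedShift_mul (hg : IsAdmissibleWeight g) (m n : Fin c → ℤ) :
    weightedShift Y hg m * weightedShift Y hg n = weightedShift Y hg (m + n) := by
  ext f k : 3
  rw [mul_apply_eq_comp, weightedShift_apply, weightedShift_apply, weightedShift_apply,
    smul_smul, ← Complex.ofReal_mul, div_mul_div_cancel₀ (hg.pos _).ne', sub_sub]

theorem weightedShift_zero (hg : IsAdmissibleWeight g) : weightedShift Y hg 0 = 1 := by
  ext f k : 3
  rw [weightedShift_apply, sub_zero, div_self (hg.pos k).ne', Complex.ofReal_one, one_smul]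
  rfl

theorem weightedShift_mul_coeffMap (hg : IsAdmissibleWeight g) (m : Fin c → ℤ) (r : Y →L[ℂ] Y) :
    weightedShift Y hg m * coeffMap c r = coeffMap c r * weightedShift Y hg m := by
  ext f k : 3
  simp only [mul_apply_eq_comp, weightedShift_apply, coeffMap_apply, map_smul]

theorem norm_weightedShift_le (hg : IsAdmissibleWeight g) (m : Fin c → ℤ) :
    ‖weightedShift Y hg m‖ ≤ g m :=
  norm_diagonalOp_le _ _ _ _

theorem norm_coeffMap_le (r : Y →L[ℂ] Y) : ‖coeffMap c r‖ ≤ ‖r‖ :=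
  norm_diagonalOp_le _ _ _ _

variable (c Y) in
/-- Coefficientwise action of operators, as a continuous linear map. -/
noncomputable def coeffMapL : (Y →L[ℂ] Y) →L[ℂ]
    (lp (fun _ : Fin c → ℤ => Y) 1 →L[ℂ] lp (fun _ : Fin c → ℤ => Y) 1) :=
  LinearMap.mkContinuous
    { toFun := coeffMap c
      map_add' := fun r s => by
        ext f k : 3
        exact (coeffMap_apply (r + s) f k).trans
          (congrArg₂ (· + ·) (coeffMap_apply r f k) (coeffMap_apply s f k)).symm
      map_smul' := fun a r => by
        ext f k : 3
        exact (coeffMap_apply (a • r) f k).trans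
          (congrArg (a • ·) (coeffMap_apply r f k)).symm } 1 fun r =>
    (norm_coeffMap_le r).trans_eq (one_mul _).symm

/-- A left version of the Bochner-Phillips theorem with weight, for a Banach algebra `𝔹` acting on
a Banach space `Y` on both sides. -/
theorem exists_convolution_left_inverse_of_bimodule [CompleteSpace 𝔹] [CompleteSpace Y]
    (hg : IsAdmissibleWeight g) (left : 𝔹 →L[ℂ] Y →L[ℂ] Y) (right : 𝔹 → Y →L[ℂ] Y)
    (hleft : ∀ r, ‖left r‖ ≤ ‖r‖) (hleft_one : ∀ y, left 1 y = y)
    (hleft_mul : ∀ r s y, left (r * s) y = left r (left s y))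
    (hcomm : ∀ r s y, right s (left r y) = left r (right s y))
    (u : Y) (hu : ∀ r, left r u = right r u)
    {a : (Fin c → ℤ) → 𝔹} (ha : Summable fun m => g m * ‖a m‖)
    (hinv : ∀ χ : (Fin c → ℤ) → ℂ, χ 0 = 1 → (∀ m n, χ (m + n) = χ m * χ n) →
      (∀ m, ‖χ m‖ = 1) → ∃ q, q * ∑' m, χ m • a m = 1) :
    ∃ f : (Fin c → ℤ) → Y, (Summable fun m => ‖f m‖) ∧
      ∀ m, HasSum (fun n => ((g m / g (m - n) : ℝ) : ℂ) • right (a n) (f (m - n)))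
        (if m = 0 then u else 0) := by
  let ℓ := (coeffMapL c Y).comp left
  let δ := weightedShift Y hg
  let K := Set.range δ ∪ Set.range fun r : 𝔹 => coeffMap c (right r)
  have hℓK : ∀ r, ℓ r ∈ Set.centralizer K := by
    rintro r _ (⟨m, rfl⟩ | ⟨s, rfl⟩)
    · exact weightedShift_mul_coeffMap hg m _
    · ext f k : 3
      change coeffMap c (right s) (coeffMap c (left r) f) k =
        coeffMap c (left r) (coeffMap c (right s) f) k
      simp only [coeffMap_apply, hcomm]
  have hδK : ∀ m, δ m ∈ Set.centralizer K := by
    rintro m _ (⟨n, rfl⟩ | ⟨s, rfl⟩)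
    · change weightedShift Y hg n * weightedShift Y hg m =
        weightedShift Y hg m * weightedShift Y hg n
      rw [weightedShift_mul, weightedShift_mul, add_comm]
    · exact (weightedShift_mul_coeffMap hg m _).symm
  obtain ⟨B, hBK, S, hS, hB⟩ := exists_left_inverse_mem_centralizer hg
    (ContinuousLinearMap.norm_id_le (𝕜 := ℂ) (E := lp (fun _ : Fin c → ℤ => Y) 1))
    (K := K) (ℓ := ℓ) (δ := δ)
    (by
      ext f k : 3
      exact (coeffMap_apply (left 1) f k).trans (hleft_one _))
    (fun r s => by
      ext f k : 3
      change coeffMap c (left (r * s)) f k = coeffMap c (left r) (coeffMap c (left s) f) k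
      simp only [coeffMap_apply, hleft_mul])
    hℓK (weightedShift_zero hg) (fun m n => (weightedShift_mul hg m n).symm)
    (norm_weightedShift_le hg) (fun m => Or.inl ⟨m, rfl⟩) hδK
    (fun r => (norm_coeffMap_le _).trans (hleft _)) ha hinv
  let e : lp (fun _ : Fin c → ℤ => Y) 1 := lp.single 1 0 u
  refine ⟨B e, by simpa using (lp.memℓp (B e)).summable (by simp), fun m => ?_⟩
  have hev : ∀ n, B ((ℓ (a n) * δ n) e) = coeffMap c (right (a n)) (δ n (B e)) := by
    intro n
    have h1 : (ℓ (a n) * δ n) e = coeffMap c (right (a n)) (δ n e) := by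
      ext k : 2
      change coeffMap c (left (a n)) (weightedShift Y hg n e) k =
        coeffMap c (right (a n)) (weightedShift Y hg n e) k
      rw [coeffMap_apply, coeffMap_apply, weightedShift_apply, lp.single_apply]
      by_cases hk : k - n = 0
      · rw [hk, Pi.single_eq_same, map_smul, map_smul, hu]
      · rw [Pi.single_eq_of_ne hk, smul_zero, map_zero, map_zero]
    rw [h1]
    have h2 := DFunLike.congr_fun (hBK _ (Or.inr ⟨a n, rfl⟩)) (δ n e)
    have h3 := DFunLike.congr_fun (hBK _ (Or.inl ⟨n, rfl⟩)) e
    simp only [mul_apply_eq_comp] at h2 h3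
    rw [← h2, ← h3]
  have hS2 : HasSum (fun n => B ((ℓ (a n) * δ n) e) m) (B (S e) m) :=
    (B.hasSum (hS.clm_apply e)).lp_apply m
  have hBS : B (S e) = e := DFunLike.congr_fun hB e
  have hem : e m = if m = 0 then u else 0 := by
    rw [lp.single_apply, Pi.single_apply]
  rw [hBS, hem] at hS2
  refine hS2.congr_fun fun n => ?_
  rw [hev, coeffMap_apply, weightedShift_apply, map_smul]

/-- A left version of the Bochner-Phillips theorem with weight: if an absolutely convergent
Fourier series with coefficients in a Banach algebra is pointwise left invertible on the dual
group, then it has a left inverse of the same kind. -/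
theorem exists_convolution_left_inverse [CompleteSpace 𝔹] (hg : IsAdmissibleWeight g)
    {a : (Fin c → ℤ) → 𝔹} (ha : Summable fun m => g m * ‖a m‖)
    (hinv : ∀ χ : (Fin c → ℤ) → ℂ, χ 0 = 1 → (∀ m n, χ (m + n) = χ m * χ n) →
      (∀ m, ‖χ m‖ = 1) → ∃ q, q * ∑' m, χ m • a m = 1) :
    ∃ b : (Fin c → ℤ) → 𝔹, (Summable fun m => g m * ‖b m‖) ∧
      ∀ m, HasSum (fun n => b (m - n) * a n) (if m = 0 then 1 else 0) := by
  obtain ⟨f, hf, hfa⟩ := exists_convolution_left_inverse_of_bimodule hg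
    (ContinuousLinearMap.mul ℂ 𝔹) (ContinuousLinearMap.mul ℂ 𝔹).flip
    (ContinuousLinearMap.opNorm_mul_apply_le ℂ 𝔹) (fun y => one_mul y)
    (fun r s y => mul_assoc r s y) (fun r s y => mul_assoc r y s) 1
    (fun r => (mul_one r).trans (one_mul r).symm) ha hinv
  have hgC : ∀ m, ((g m : ℝ) : ℂ) ≠ 0 := fun m => Complex.ofReal_ne_zero.2 (hg.pos m).ne'
  refine ⟨fun m => ((g m : ℝ) : ℂ)⁻¹ • f m, hf.congr fun m => ?_, fun m => ?_⟩
  · rw [norm_smul, norm_inv, Complex.norm_of_nonneg (hg.pos m).le,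
      mul_inv_cancel_left₀ (hg.pos m).ne']
  · have h4 := (hfa m).const_smul (((g m : ℝ) : ℂ)⁻¹)
    have h5 : ((g m : ℝ) : ℂ)⁻¹ • (if m = 0 then (1 : 𝔹) else 0) = if m = 0 then 1 else 0 := by
      by_cases hm : m = 0
      · simp [hm, hg.map_zero]
      · simp [hm]
    rw [h5] at h4
    refine h4.congr_fun fun n => ?_
    change _ = _ • _ • (_ * a n)
    rw [smul_mul_assoc, smul_smul, Complex.ofReal_div, div_eq_mul_inv,
      inv_mul_cancel_left₀ (hgC m)]

end WeightedConvolution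

section SummableMatrices

variable {c : ℕ} {g : (Fin c → ℤ) → ℝ} {p : ℝ≥0∞} [Fact (1 ≤ p)] {X : Type*}
  [NormedAddCommGroup X] [NormedSpace ℂ X]

/-- The class `s_{1,g}(ℤ^c, B(X))` of operators on `l_p(ℤ^c, X)` whose matrix is dominated by a
family of `l_{1,g}`. -/
def IsSummableMatrix (g : (Fin c → ℤ) → ℝ)
    (T : lp (fun _ : Fin c → ℤ => X) p →L[ℂ] lp (fun _ : Fin c → ℤ => X) p) : Prop :=
  ∃ (b : (Fin c → ℤ) → (Fin c → ℤ) → (X →L[ℂ] X)) (β : (Fin c → ℤ) → ℝ),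
    (Summable fun m => g m * β m) ∧ (∀ k m, ‖b k m‖ ≤ β m) ∧
    (∀ x k, HasSum (fun m => b k m (x (k - m))) (T x k))

theorem IsAdmissibleWeight.summable_of_mul (hg : IsAdmissibleWeight g) {β : (Fin c → ℤ) → ℝ}
    (hβ : ∀ m, 0 ≤ β m) (h : Summable fun m => g m * β m) : Summable β :=
  h.of_nonneg_of_le hβ fun m => le_mul_of_one_le_left (hβ m) (hg.one_le m)

theorem isSummableMatrix_smul_one (g : (Fin c → ℤ) → ℝ) (z : ℂ) :
    IsSummableMatrix g (z • (1 : lp (fun _ : Fin c → ℤ => X) p →L[ℂ]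
      lp (fun _ : Fin c → ℤ => X) p)) := by
  classical
  refine ⟨fun _ m => if m = 0 then z • 1 else 0, fun m => if m = 0 then ‖z‖ else 0, ?_, ?_, ?_⟩
  · refine summable_of_ne_finset_zero (s := {0}) fun m hm => ?_
    simp [Finset.notMem_singleton.1 hm]
  · intro k m
    by_cases hm : m = 0
    · simp only [hm, if_true]
      rw [norm_smul]
      exact mul_le_of_le_one_right (norm_nonneg _) ContinuousLinearMap.norm_id_le
    · simp [hm]
  · intro x k
    have h := hasSum_single (f := fun m => (if m = 0 then z • (1 : X →L[ℂ] X) else 0) (x (k - m)))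
      0 fun m hm => by simp [hm]
    simpa using h

theorem IsSummableMatrix.add
    {S T : lp (fun _ : Fin c → ℤ => X) p →L[ℂ] lp (fun _ : Fin c → ℤ => X) p}
    (hS : IsSummableMatrix g S) (hT : IsSummableMatrix g T) : IsSummableMatrix g (S + T) := by
  obtain ⟨b, β, h1, h2, h3⟩ := hS
  obtain ⟨b', β', h1', h2', h3'⟩ := hT
  refine ⟨fun k m => b k m + b' k m, fun m => β m + β' m, ?_, fun k m => ?_, fun x k => ?_⟩
  · simpa only [mul_add] using h1.add h1'
  · exact (norm_add_le _ _).trans (add_le_add (h2 k m) (h2' k m))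
  · exact (h3 x k).add (h3' x k)

theorem IsSummableMatrix.smul
    {T : lp (fun _ : Fin c → ℤ => X) p →L[ℂ] lp (fun _ : Fin c → ℤ => X) p}
    (hT : IsSummableMatrix g T) (z : ℂ) : IsSummableMatrix g (z • T) := by
  obtain ⟨b, β, h1, h2, h3⟩ := hT
  refine ⟨fun k m => z • b k m, fun m => ‖z‖ * β m, ?_, fun k m => ?_, fun x k => ?_⟩
  · simpa only [mul_left_comm] using h1.mul_left ‖z‖
  · rw [norm_smul]
    exact mul_le_mul_of_nonneg_left (h2 k m) (norm_nonneg _)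
  · exact (h3 x k).const_smul z

theorem hasSum_of_hasSum_apply [CompleteSpace X] {ι G : Type*}
    {T : ι → lp (fun _ : G => X) p →L[ℂ] lp (fun _ : G => X) p}
    {S : lp (fun _ : G => X) p →L[ℂ] lp (fun _ : G => X) p} (hT : Summable fun i => ‖T i‖)
    (h : ∀ x k, HasSum (fun i => T i x k) (S x k)) : HasSum T S := by
  obtain ⟨R, hR⟩ := hT.of_norm
  have hRS : R = S := by
    ext x k : 3
    exact ((hR.clm_apply x).lp_apply k).unique (h x k)
  exact hRS ▸ hR

/-- Multiplication by a unimodular scalar family on `l_p(ℤ^c, X)`. -/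
noncomputable def modulation (p : ℝ≥0∞) [Fact (1 ≤ p)] (X : Type*) [NormedAddCommGroup X]
    [NormedSpace ℂ X] (χ : (Fin c → ℤ) → ℂ) (hχ : ∀ m, ‖χ m‖ = 1) :
    lp (fun _ : Fin c → ℤ => X) p →L[ℂ] lp (fun _ : Fin c → ℤ => X) p :=
  diagonalOp (fun k => χ k • ContinuousLinearMap.id ℂ X) 1 (fun k => by
    rw [norm_smul, hχ, one_mul]
    exact ContinuousLinearMap.norm_id_le) 0

theorem modulation_apply (χ : (Fin c → ℤ) → ℂ) (hχ : ∀ m, ‖χ m‖ = 1)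
    (x : lp (fun _ : Fin c → ℤ => X) p) (k : Fin c → ℤ) :
    modulation p X χ hχ x k = χ k • x k := by
  simp [modulation]

/-- Conjugation by a modulation multiplies the `m`-th diagonal of an operator by `χ(m)`; in
particular it preserves invertibility. -/
theorem exists_left_inverse_tsum_smul_diagonalOp [CompleteSpace X]
    {T Q : lp (fun _ : Fin c → ℤ => X) p →L[ℂ] lp (fun _ : Fin c → ℤ => X) p} (hQT : Q * T = 1)
    {d : (Fin c → ℤ) → (Fin c → ℤ) → X →L[ℂ] X} {β : (Fin c → ℤ) → ℝ}
    (hdβ : ∀ k m, ‖d k m‖ ≤ β m) (hβ : Summable β)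
    (hd : ∀ x k, HasSum (fun m => d k m (x (k - m))) (T x k))
    {χ : (Fin c → ℤ) → ℂ} (hadd : ∀ m n, χ (m + n) = χ m * χ n) (hnorm : ∀ m, ‖χ m‖ = 1) :
    ∃ q, q * ∑' m, χ m • (diagonalOp (fun k => d k m) (β m) (fun k => hdβ k m) m :
      lp (fun _ : Fin c → ℤ => X) p →L[ℂ] lp (fun _ : Fin c → ℤ => X) p) = 1 := by
  have hnorm' : ∀ m, ‖(χ m)⁻¹‖ = 1 := fun m => by rw [norm_inv, hnorm, inv_one]
  have hne : ∀ m, χ m ≠ 0 := fun m => norm_ne_zero_iff.1 (by rw [hnorm]; exact one_ne_zero)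
  let U := modulation p X χ hnorm
  let V := modulation p X (fun m => (χ m)⁻¹) hnorm'
  have hUV : U * V = 1 := by
    ext x k : 3
    change U (V x) k = x k
    rw [modulation_apply, modulation_apply, smul_inv_smul₀ (hne k)]
  have hVU : V * U = 1 := by
    ext x k : 3
    change V (U x) k = x k
    rw [modulation_apply, modulation_apply, inv_smul_smul₀ (hne k)]
  have hsum : HasSum (fun m => χ m • (diagonalOp (fun k => d k m) (β m) (fun k => hdβ k m) m :
      lp (fun _ : Fin c → ℤ => X) p →L[ℂ] lp (fun _ : Fin c → ℤ => X) p)) (U * T * V) := by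
    refine hasSum_of_hasSum_apply (hβ.of_nonneg_of_le (fun m => norm_nonneg _) fun m => ?_) ?_
    · rw [norm_smul, hnorm, one_mul]
      exact norm_diagonalOp_le _ _ _ _
    · intro x k
      change HasSum (fun m => χ m • d k m (x (k - m))) (U (T (V x)) k)
      rw [modulation_apply]
      refine ((hd (V x) k).const_smul (χ k)).congr_fun fun m => ?_
      rw [modulation_apply, map_smul, smul_smul]
      congr 1
      have hk : χ k = χ m * χ (k - m) := by rw [← hadd, add_sub_cancel]
      rw [hk, mul_inv_cancel_right₀ (hne _)]
  refine ⟨U * Q * V, ?_⟩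
  rw [hsum.tsum_eq]
  calc U * Q * V * (U * T * V) = U * (Q * ((V * U) * T)) * V := by simp only [mul_assoc]
    _ = 1 := by rw [hVU, one_mul, hQT, mul_one, hUV]

/-- The entry of an operator on `l_p(ℤ^c, X)` in the row `k` on the `m`-th diagonal. -/
noncomputable def matrixEntry
    (B : lp (fun _ : Fin c → ℤ => X) p →L[ℂ] lp (fun _ : Fin c → ℤ => X) p)
    (k m : Fin c → ℤ) : X →L[ℂ] X :=
  (lp.evalCLM ℂ (fun _ : Fin c → ℤ => X) p k).comp
    (B.comp (lp.singleContinuousLinearMap ℂ (fun _ : Fin c → ℤ => X) p (k - m)))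

theorem matrixEntry_apply
    (B : lp (fun _ : Fin c → ℤ => X) p →L[ℂ] lp (fun _ : Fin c → ℤ => X) p)
    (k m : Fin c → ℤ) (v : X) : matrixEntry B k m v = B (lp.single p (k - m) v) k :=
  rfl

theorem norm_matrixEntry_le
    (B : lp (fun _ : Fin c → ℤ => X) p →L[ℂ] lp (fun _ : Fin c → ℤ => X) p)
    (k m : Fin c → ℤ) : ‖matrixEntry B k m‖ ≤ ‖B‖ := by
  have hp0 : 0 < p := zero_lt_one.trans_le Fact.out
  refine ContinuousLinearMap.opNorm_le_bound _ (norm_nonneg _) fun v => ?_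
  rw [matrixEntry_apply]
  refine (lp.norm_apply_le_norm hp0.ne' _ k).trans ((B.le_opNorm _).trans_eq ?_)
  rw [lp.norm_single hp0]

/-- The `m`-th diagonal of an operator on `l_p(ℤ^c, X)`. -/
noncomputable def diagonalPart
    (B : lp (fun _ : Fin c → ℤ => X) p →L[ℂ] lp (fun _ : Fin c → ℤ => X) p) (m : Fin c → ℤ) :
    lp (fun _ : Fin c → ℤ => X) p →L[ℂ] lp (fun _ : Fin c → ℤ => X) p :=
  diagonalOp (fun k => matrixEntry B k m) ‖B‖ (fun k => norm_matrixEntry_le B k m) m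

theorem diagonalPart_apply
    (B : lp (fun _ : Fin c → ℤ => X) p →L[ℂ] lp (fun _ : Fin c → ℤ => X) p)
    (k m : Fin c → ℤ) (x : lp (fun _ : Fin c → ℤ => X) p) :
    diagonalPart B m x k = B (lp.single p (k - m) (x (k - m))) k :=
  rfl

theorem norm_diagonalPart_le
    (B : lp (fun _ : Fin c → ℤ => X) p →L[ℂ] lp (fun _ : Fin c → ℤ => X) p)
    (m : Fin c → ℤ) : ‖diagonalPart B m‖ ≤ ‖B‖ :=
  norm_diagonalOp_le _ _ _ _

theorem diagonalOp_single (d : (Fin c → ℤ) → X →L[ℂ] X) (C : ℝ) (hd : ∀ k, ‖d k‖ ≤ C)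
    (m k : Fin c → ℤ) (v : X) :
    (diagonalOp d C hd m (lp.single p k v) : lp (fun _ : Fin c → ℤ => X) p) =
      lp.single p (k + m) (d (k + m) v) := by
  ext j : 2
  rw [diagonalOp_apply, lp.single_apply, lp.single_apply]
  by_cases hj : j = k + m
  · subst hj
    rw [add_sub_cancel_right, Pi.single_eq_same, Pi.single_eq_same]
  · have h : j - m ≠ k := fun h => hj (by rw [← h, sub_add_cancel])
    rw [Pi.single_eq_of_ne hj, Pi.single_eq_of_ne h, map_zero]

/-- Taking diagonals is a module map over the operators concentrated on one diagonal. -/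
theorem diagonalPart_mul_diagonalOp_apply
    (B : lp (fun _ : Fin c → ℤ => X) p →L[ℂ] lp (fun _ : Fin c → ℤ => X) p)
    (d : (Fin c → ℤ) → X →L[ℂ] X) (C : ℝ) (hd : ∀ k, ‖d k‖ ≤ C) (l n k : Fin c → ℤ)
    (x : lp (fun _ : Fin c → ℤ => X) p) :
    diagonalPart B (l - n) (diagonalOp d C hd n x) k =
      B (diagonalOp d C hd n (lp.single p (k - l) (x (k - l)))) k := by
  have h : k - (l - n) = k - l + n := by abel
  rw [diagonalPart_apply, diagonalOp_single, diagonalOp_apply, h, add_sub_cancel_right]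

theorem hasSum_diagonalPart_mul [CompleteSpace X]
    {a b : (Fin c → ℤ) → lp (fun _ : Fin c → ℤ => X) p →L[ℂ] lp (fun _ : Fin c → ℤ => X) p}
    {d : (Fin c → ℤ) → (Fin c → ℤ) → X →L[ℂ] X} {β : (Fin c → ℤ) → ℝ}
    (hdβ : ∀ k m, ‖d k m‖ ≤ β m)
    (ha : ∀ m, a m = diagonalOp (fun k => d k m) (β m) (fun k => hdβ k m) m) {l : Fin c → ℤ}
    (hs : Summable fun n => ‖diagonalPart (b (l - n)) (l - n) * a n‖)
    (hba : HasSum (fun n => b (l - n) * a n) (if l = 0 then 1 else 0)) :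
    HasSum (fun n => diagonalPart (b (l - n)) (l - n) * a n) (if l = 0 then 1 else 0) := by
  refine hasSum_of_hasSum_apply hs fun x k => ?_
  have h1 := (hba.clm_apply (lp.single p (k - l) (x (k - l)))).lp_apply k
  have h2 : (if l = 0 then (1 : lp (fun _ : Fin c → ℤ => X) p →L[ℂ]
      lp (fun _ : Fin c → ℤ => X) p) else 0) (lp.single p (k - l) (x (k - l))) k =
      (if l = 0 then (1 : lp (fun _ : Fin c → ℤ => X) p →L[ℂ]
      lp (fun _ : Fin c → ℤ => X) p) else 0) x k := by
    by_cases hl : l = 0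
    · subst hl
      rw [if_pos rfl, sub_zero]
      change Pi.single (M := fun _ : Fin c → ℤ => X) k (x k) k = x k
      rw [Pi.single_eq_same]
    · rw [if_neg hl]
      rfl
  rw [h2] at h1
  refine h1.congr_fun fun n => ?_
  rw [mul_apply_eq_comp, mul_apply_eq_comp, ha n, diagonalPart_mul_diagonalOp_apply]

/-- If `s * t` is expanded as a convolution of absolutely convergent series and only the
zeroth coefficient of this convolution survives, then the product is that coefficient. -/
theorem mul_eq_of_hasSum_convolution {G R : Type*} [AddCommGroup G] [DecidableEq G] [NormedRing R]
    [CompleteSpace R] {r a : G → R} {s t u : R} (hr : Summable fun m => ‖r m‖)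
    (ha : Summable fun m => ‖a m‖) (hs : HasSum r s) (ht : HasSum a t)
    (h : ∀ l, (Summable fun n => ‖r (l - n) * a n‖) →
      HasSum (fun n => r (l - n) * a n) (if l = 0 then u else 0)) : s * t = u := by
  let e : G × G ≃ G × G :=
    { toFun := fun x => (x.1 - x.2, x.2)
      invFun := fun x => (x.1 + x.2, x.2)
      left_inv := fun x => by simp
      right_inv := fun x => by simp }
  have hprod : HasSum (fun x : G × G => r (x.1 - x.2) * a x.2) (s * t) :=
    (e.hasSum_iff (f := fun x : G × G => r x.1 * a x.2)).2
      (hs.mul ht (summable_mul_of_summable_norm hr ha))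
  have hnorm : Summable fun x : G × G => ‖r (x.1 - x.2) * a x.2‖ :=
    (e.summable_iff (f := fun x : G × G => ‖r x.1 * a x.2‖)).2 (hr.mul_norm ha)
  have hfib : ∀ l, HasSum (fun n => r (l - n) * a n) (if l = 0 then u else 0) :=
    fun l => h l (hnorm.prod_factor l)
  have hsum : HasSum (fun l : G => if l = 0 then u else 0) (s * t) := hprod.prod_fiberwise hfib
  exact hsum.unique (hasSum_ite_eq 0 u)

/-- Wiener's lemma for `s_{1,g}(ℤ^c, B(X))`: this class is closed under inversion. -/
theorem IsSummableMatrix.inverse [CompleteSpace X] (hg : IsAdmissibleWeight g)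
    {T Q : lp (fun _ : Fin c → ℤ => X) p →L[ℂ] lp (fun _ : Fin c → ℤ => X) p}
    (hT : IsSummableMatrix g T) (hTQ : T * Q = 1) (hQT : Q * T = 1) : IsSummableMatrix g Q := by
  obtain ⟨d, β, hβs, hdβ, hd⟩ := hT
  have hβ0 : ∀ m, 0 ≤ β m := fun m => (norm_nonneg _).trans (hdβ 0 m)
  let a : (Fin c → ℤ) → lp (fun _ : Fin c → ℤ => X) p →L[ℂ] lp (fun _ : Fin c → ℤ => X) p :=
    fun m => diagonalOp (fun k => d k m) (β m) (fun k => hdβ k m) m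
  have haβ : ∀ m, ‖a m‖ ≤ β m := fun m => norm_diagonalOp_le _ _ _ _
  have ha : Summable fun m => g m * ‖a m‖ := hβs.of_nonneg_of_le
    (fun m => mul_nonneg (hg.pos m).le (norm_nonneg _))
    fun m => mul_le_mul_of_nonneg_left (haβ m) (hg.pos m).le
  have ha' : Summable fun m => ‖a m‖ := hg.summable_of_mul (fun m => norm_nonneg _) ha
  have haT : HasSum a T := hasSum_of_hasSum_apply ha' hd
  obtain ⟨b, hb, hba⟩ := exists_convolution_left_inverse hg ha fun χ _ hadd hnorm =>
    exists_left_inverse_tsum_smul_diagonalOp hQT hdβ (hg.summable_of_mul hβ0 hβs) hd hadd hnorm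
  have hb' : Summable fun m => ‖b m‖ := hg.summable_of_mul (fun m => norm_nonneg _) hb
  have hr : Summable fun m => ‖diagonalPart (b m) m‖ :=
    hb'.of_nonneg_of_le (fun m => norm_nonneg _) fun m => norm_diagonalPart_le _ _
  obtain ⟨s, hs⟩ := hr.of_norm
  have hone : s * T = 1 := mul_eq_of_hasSum_convolution hr ha' hs haT fun l hl =>
    hasSum_diagonalPart_mul hdβ (fun m => rfl) hl (hba l)
  have hsQ : s = Q := by
    calc s = s * (T * Q) := by rw [hTQ, mul_one]
      _ = Q := by rw [← mul_assoc, hone, one_mul]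
  subst hsQ
  exact ⟨fun k m => matrixEntry (b m) k m, fun m => ‖b m‖, hb,
    fun k m => norm_matrixEntry_le _ _ _, fun x k => (hs.clm_apply x).lp_apply k⟩

end SummableMatrices

section Nuclear

variable {X : Type*} [NormedAddCommGroup X] [NormedSpace ℂ X]

theorem nuclearNorm_le_tsum {A : X →L[ℂ] X} {a : ℕ → X →L[ℂ] ℂ} {y : ℕ → X}
    (h : NuclearRep A a y) : nuclearNorm A ≤ ∑' i, ‖a i‖ * ‖y i‖ := by
  refine csInf_le ⟨0, ?_⟩ ⟨a, y, h, rfl⟩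
  rintro _ ⟨a', y', -, rfl⟩
  exact tsum_nonneg fun i => by positivity

theorem IsNuclear.exists_tsum_lt {A : X →L[ℂ] X} (hA : IsNuclear A) {r : ℝ}
    (hr : nuclearNorm A < r) :
    ∃ a y, NuclearRep A a y ∧ ∑' i, ‖a i‖ * ‖y i‖ < r := by
  obtain ⟨a, y, h⟩ := hA
  obtain ⟨_, ⟨a', y', h', rfl⟩, hlt⟩ := exists_lt_of_csInf_lt
    (s := {r | ∃ a y, NuclearRep A a y ∧ r = ∑' i, ‖a i‖ * ‖y i‖}) ⟨_, a, y, h, rfl⟩ hr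
  exact ⟨a', y', h', hlt⟩

theorem NuclearRep.norm_le {A : X →L[ℂ] X} {a : ℕ → X →L[ℂ] ℂ} {y : ℕ → X}
    (h : NuclearRep A a y) : ‖A‖ ≤ ∑' i, ‖a i‖ * ‖y i‖ := by
  refine A.opNorm_le_bound (tsum_nonneg fun i => by positivity) fun x => ?_
  rw [← (h.2 x).tsum_eq, ← tsum_mul_right]
  refine tsum_of_norm_bounded (h.1.mul_right ‖x‖).hasSum fun i => ?_
  rw [norm_smul, mul_right_comm]
  exact mul_le_mul_of_nonneg_right ((a i).le_opNorm x) (norm_nonneg _)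

theorem IsNuclear.norm_le_nuclearNorm {A : X →L[ℂ] X} (hA : IsNuclear A) :
    ‖A‖ ≤ nuclearNorm A := by
  obtain ⟨a, y, h⟩ := hA
  refine le_csInf ⟨_, a, y, h, rfl⟩ ?_
  rintro _ ⟨_, _, hrep, rfl⟩
  exact hrep.norm_le

/-- Nuclear representations may be indexed by any countable type. -/
theorem exists_nuclearRep_of_countable {ι : Type*} [Countable ι] {A : X →L[ℂ] X}
    {a : ι → X →L[ℂ] ℂ} {y : ι → X} (hs : Summable fun i => ‖a i‖ * ‖y i‖)
    (h : ∀ x, HasSum (fun i => a i x • y i) (A x)) :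
    ∃ a' y', NuclearRep A a' y' ∧ ∑' i, ‖a' i‖ * ‖y' i‖ = ∑' i, ‖a i‖ * ‖y i‖ := by
  obtain ⟨e, he⟩ := exists_injective_nat ι
  have h1 : (fun i => ‖Function.extend e a 0 i‖ * ‖Function.extend e y 0 i‖) =
      Function.extend e (fun i => ‖a i‖ * ‖y i‖) 0 := by
    funext j
    by_cases hj : ∃ i, e i = j
    · obtain ⟨i, rfl⟩ := hj
      simp only [he.extend_apply]
    · simp only [Function.extend_apply' _ _ _ hj, Pi.zero_apply, norm_zero, mul_zero]
  have h2 : ∀ x, (fun i => Function.extend e a 0 i x • Function.extend e y 0 i) =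
      Function.extend e (fun i => a i x • y i) 0 := by
    intro x
    funext j
    by_cases hj : ∃ i, e i = j
    · obtain ⟨i, rfl⟩ := hj
      simp only [he.extend_apply]
    · simp only [Function.extend_apply' _ _ _ hj, Pi.zero_apply, smul_zero]
  have h3 : HasSum (fun i => ‖Function.extend e a 0 i‖ * ‖Function.extend e y 0 i‖)
      (∑' i, ‖a i‖ * ‖y i‖) := by
    rw [h1, hasSum_extend_zero he]
    exact hs.hasSum
  refine ⟨Function.extend e a 0, Function.extend e y 0, ⟨h3.summable, fun x => ?_⟩, h3.tsum_eq⟩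
  rw [h2, hasSum_extend_zero he]
  exact h x

theorem NuclearRep.comp {A : X →L[ℂ] X} {a : ℕ → X →L[ℂ] ℂ} {y : ℕ → X}
    (h : NuclearRep A a y) (B : X →L[ℂ] X) :
    NuclearRep (A ∘L B) (fun i => a i ∘L B) y ∧
      ∑' i, ‖a i ∘L B‖ * ‖y i‖ ≤ (∑' i, ‖a i‖ * ‖y i‖) * ‖B‖ := by
  have hle : ∀ i, ‖a i ∘L B‖ * ‖y i‖ ≤ ‖a i‖ * ‖y i‖ * ‖B‖ := fun i => by
    rw [mul_right_comm]
    exact mul_le_mul_of_nonneg_right ((a i).opNorm_comp_le B) (norm_nonneg _)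
  have hs : Summable fun i => ‖a i ∘L B‖ * ‖y i‖ :=
    (h.1.mul_right ‖B‖).of_nonneg_of_le (fun i => by positivity) hle
  refine ⟨⟨hs, fun x => h.2 (B x)⟩, ?_⟩
  rw [← tsum_mul_right]
  exact hs.tsum_le_tsum hle (h.1.mul_right ‖B‖)

theorem IsNuclear.comp {A : X →L[ℂ] X} (hA : IsNuclear A) (B : X →L[ℂ] X) :
    IsNuclear (A ∘L B) := by
  obtain ⟨a, y, h⟩ := hA
  exact ⟨_, _, (h.comp B).1⟩

theorem IsNuclear.nuclearNorm_comp_le {A : X →L[ℂ] X} (hA : IsNuclear A) (B : X →L[ℂ] X) :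
    nuclearNorm (A ∘L B) ≤ nuclearNorm A * ‖B‖ := by
  have h : ∀ r > nuclearNorm A, nuclearNorm (A ∘L B) ≤ r * ‖B‖ := by
    intro r hr
    obtain ⟨a, y, h, hlt⟩ := hA.exists_tsum_lt hr
    exact (nuclearNorm_le_tsum (h.comp B).1).trans ((h.comp B).2.trans
      (mul_le_mul_of_nonneg_right hlt.le (norm_nonneg _)))
  refine ge_of_tendsto (x := 𝓝[>] nuclearNorm A) (f := fun r => r * ‖B‖) ?_ ?_
  · exact ((continuous_id.mul continuous_const).tendsto _).mono_left nhdsWithin_le_nhds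
  · filter_upwards [self_mem_nhdsWithin] with r hr
    exact h r hr

/-- The sum of a series of nuclear operators with summable nuclear norms is nuclear. -/
theorem exists_nuclearRep_of_hasSum [CompleteSpace X] {ι : Type*} [Countable ι]
    {B : ι → X →L[ℂ] X} {γ : ι → ℝ} (hB : ∀ i, IsNuclear (B i))
    (hBγ : ∀ i, nuclearNorm (B i) ≤ γ i) (hγ : Summable γ) {S : X →L[ℂ] X}
    (hS : ∀ x, HasSum (fun i => B i x) (S x)) {ε : ℝ} (hε : 0 < ε) :
    ∃ a y, NuclearRep S a y ∧ ∑' i, ‖a i‖ * ‖y i‖ ≤ ∑' i, γ i + ε := by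
  have := Encodable.ofCountable ι
  obtain ⟨ε', hε', s, hs, hsε⟩ := posSumOfEncodable hε ι
  choose a y hr hlt using fun i =>
    (hB i).exists_tsum_lt ((hBγ i).trans_lt (lt_add_of_pos_right _ (hε' i)))
  have hsum : Summable fun i => γ i + ε' i := hγ.add hs.summable
  have hs1 : Summable fun i => ∑' j, ‖a i j‖ * ‖y i j‖ :=
    hsum.of_nonneg_of_le (fun i => tsum_nonneg fun j => by positivity) fun i => (hlt i).le
  have hs2 : Summable fun x : ι × ℕ => ‖a x.1 x.2‖ * ‖y x.1 x.2‖ :=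
    (summable_prod_of_nonneg fun x => by positivity).2 ⟨fun i => (hr i).1, hs1⟩
  have hx : ∀ x, HasSum (fun q : ι × ℕ => a q.1 q.2 x • y q.1 q.2) (S x) := by
    intro x
    obtain ⟨t, ht⟩ : Summable fun q : ι × ℕ => a q.1 q.2 x • y q.1 q.2 := by
      refine Summable.of_norm_bounded (hs2.mul_right ‖x‖) fun q => ?_
      rw [norm_smul, mul_right_comm]
      exact mul_le_mul_of_nonneg_right ((a q.1 q.2).le_opNorm x) (norm_nonneg _)
    have h1 : HasSum (fun i => B i x) t := ht.prod_fiberwise fun i => (hr i).2 x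
    exact h1.unique (hS x) ▸ ht
  obtain ⟨a', y', h', heq⟩ := exists_nuclearRep_of_countable hs2 hx
  refine ⟨a', y', h', ?_⟩
  rw [heq, hs2.tsum_prod' fun i => (hr i).1]
  calc ∑' i, ∑' j, ‖a i j‖ * ‖y i j‖ ≤ ∑' i, (γ i + ε' i) :=
        hs1.tsum_le_tsum (fun i => (hlt i).le) hsum
    _ = ∑' i, γ i + s := by rw [hγ.tsum_add hs.summable, hs.tsum_eq]
    _ ≤ _ := by gcongr

theorem isNuclear_of_hasSum [CompleteSpace X] {ι : Type*} [Countable ι]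
    {B : ι → X →L[ℂ] X} {γ : ι → ℝ} (hB : ∀ i, IsNuclear (B i))
    (hBγ : ∀ i, nuclearNorm (B i) ≤ γ i) (hγ : Summable γ) {S : X →L[ℂ] X}
    (hS : ∀ x, HasSum (fun i => B i x) (S x)) : IsNuclear S := by
  obtain ⟨a, y, h, -⟩ := exists_nuclearRep_of_hasSum hB hBγ hγ hS one_pos
  exact ⟨a, y, h⟩

theorem nuclearNorm_le_of_hasSum [CompleteSpace X] {ι : Type*} [Countable ι]
    {B : ι → X →L[ℂ] X} {γ : ι → ℝ} (hB : ∀ i, IsNuclear (B i))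
    (hBγ : ∀ i, nuclearNorm (B i) ≤ γ i) (hγ : Summable γ) {S : X →L[ℂ] X}
    (hS : ∀ x, HasSum (fun i => B i x) (S x)) : nuclearNorm S ≤ ∑' i, γ i := by
  refine le_of_forall_pos_le_add fun ε hε => ?_
  obtain ⟨a, y, h, hle⟩ := exists_nuclearRep_of_hasSum hB hBγ hγ hS hε
  exact (nuclearNorm_le_tsum h).trans hle

theorem nuclearRep_zero : NuclearRep (0 : X →L[ℂ] X) 0 0 :=
  ⟨by simp, fun x => by simp⟩

theorem nuclearNorm_zero_le : nuclearNorm (0 : X →L[ℂ] X) ≤ 0 :=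
  (nuclearNorm_le_tsum nuclearRep_zero).trans_eq (by simp)

/-- A Banach space with nuclear identity operator is finite-dimensional. -/
theorem finiteDimensional_of_isNuclear_one [CompleteSpace X]
    (h : IsNuclear (1 : X →L[ℂ] X)) : FiniteDimensional ℂ X := by
  obtain ⟨a, y, hs, hx⟩ := h
  obtain ⟨N, hN⟩ : ∃ N : ℕ, ∑' i, ‖a (i + N)‖ * ‖y (i + N)‖ < 1 :=
    ((tendsto_sum_nat_add fun i => ‖a i‖ * ‖y i‖).eventually_lt_const one_pos).exists
  let F : X →L[ℂ] X := ∑ i ∈ Finset.range N, (a i).smulRight (y i)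
  have hF : ‖1 - F‖ < 1 := by
    refine lt_of_le_of_lt (ContinuousLinearMap.opNorm_le_bound _
      (tsum_nonneg fun i => by positivity) fun x => ?_) hN
    have h1 := (hasSum_nat_add_iff' N).2 (hx x)
    have h2 : (1 - F) x = (1 : X →L[ℂ] X) x - ∑ i ∈ Finset.range N, a i x • y i := by
      simp [F]
    rw [h2, ← h1.tsum_eq, ← tsum_mul_right]
    refine tsum_of_norm_bounded (((summable_nat_add_iff N).2 hs).mul_right ‖x‖).hasSum fun i => ?_
    rw [norm_smul, mul_right_comm]
    exact mul_le_mul_of_nonneg_right ((a (i + N)).le_opNorm x) (norm_nonneg _)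
  have hU : IsUnit F := by simpa using isUnit_one_sub_of_norm_lt_one hF
  have hsurj : Function.Surjective F := (ContinuousLinearMap.isUnit_iff_bijective.1 hU).2
  have htop : Submodule.span ℂ (y '' (Finset.range N : Set ℕ)) = ⊤ := by
    refine Submodule.eq_top_iff'.2 fun v => ?_
    obtain ⟨x, rfl⟩ := hsurj v
    simp only [F, sum_apply, ContinuousLinearMap.smulRight_apply]
    exact Submodule.sum_mem _ fun i hi => Submodule.smul_mem _ _
      (Submodule.subset_span ⟨i, hi, rfl⟩)
  exact ⟨htop ▸ Submodule.fg_span ((Finset.finite_toSet _).image y)⟩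

end Nuclear

section LocallyNuclear

variable {c : ℕ} {g : (Fin c → ℤ) → ℝ} {p : ℝ≥0∞} [Fact (1 ≤ p)] {X : Type*}
  [NormedAddCommGroup X] [NormedSpace ℂ X]

theorem isLocallyNuclear_zero (g : (Fin c → ℤ) → ℝ) :
    IsLocallyNuclear g (0 : lp (fun _ : Fin c → ℤ => X) p →L[ℂ]
      lp (fun _ : Fin c → ℤ => X) p) :=
  ⟨fun _ _ => 0, fun _ => 0, by simp, fun _ _ => ⟨0, 0, nuclearRep_zero⟩,
    fun _ _ => nuclearNorm_zero_le, fun _ _ => hasSum_zero⟩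

theorem IsLocallyNuclear.isSummableMatrix
    {A : lp (fun _ : Fin c → ℤ => X) p →L[ℂ] lp (fun _ : Fin c → ℤ => X) p}
    (hA : IsLocallyNuclear g A) : IsSummableMatrix g A := by
  obtain ⟨b, β, hβ, hb, hbβ, h⟩ := hA
  exact ⟨b, fun m => |β m|, hβ, fun k m =>
    (hb k m).norm_le_nuclearNorm.trans ((hbβ k m).trans (le_abs_self _)), h⟩

theorem IsLocallyNuclear.add [CompleteSpace X] (hg : IsAdmissibleWeight g)
    {A B : lp (fun _ : Fin c → ℤ => X) p →L[ℂ] lp (fun _ : Fin c → ℤ => X) p}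
    (hA : IsLocallyNuclear g A) (hB : IsLocallyNuclear g B) : IsLocallyNuclear g (A + B) := by
  obtain ⟨b, β, hβ, hb, hbβ, h⟩ := hA
  obtain ⟨b', β', hβ', hb', hbβ', h'⟩ := hB
  have hnuc : ∀ k m (i : Bool), IsNuclear (cond i (b k m) (b' k m)) := fun k m i => by
    cases i
    exacts [hb' k m, hb k m]
  have hnorm : ∀ k m (i : Bool), nuclearNorm (cond i (b k m) (b' k m)) ≤ cond i (β m) (β' m) :=
    fun k m i => by
      cases i
      exacts [hbβ' k m, hbβ k m]
  have hsum : ∀ k m x, HasSum (fun i : Bool => (cond i (b k m) (b' k m)) x)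
      ((b k m + b' k m) x) := fun k m x => by
    simpa using hasSum_fintype fun i : Bool => (cond i (b k m) (b' k m)) x
  refine ⟨fun k m => b k m + b' k m, fun m => β m + β' m, ?_, fun k m =>
    isNuclear_of_hasSum (hnuc k m) (hnorm k m) (hasSum_fintype _).summable (hsum k m),
    fun k m => ?_, fun x k => (h x k).add (h' x k)⟩
  · refine (hβ.add hβ').of_nonneg_of_le
      (fun m => mul_nonneg (hg.pos m).le (abs_nonneg _)) fun m => ?_
    rw [← mul_add]
    exact mul_le_mul_of_nonneg_left (abs_add_le _ _) (hg.pos m).le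
  · have h1 := nuclearNorm_le_of_hasSum (hnuc k m) (hnorm k m) (hasSum_fintype _).summable
      (hsum k m)
    simpa using h1

theorem summable_weighted_convolution (hg : IsAdmissibleWeight g) {β γ : (Fin c → ℤ) → ℝ}
    (hβ0 : ∀ m, 0 ≤ β m) (hγ0 : ∀ m, 0 ≤ γ m) (hβ : Summable fun m => g m * β m)
    (hγ : Summable fun m => g m * γ m) :
    Summable fun x : (Fin c → ℤ) × (Fin c → ℤ) => g x.1 * (β x.2 * γ (x.1 - x.2)) := by
  let e : (Fin c → ℤ) × (Fin c → ℤ) ≃ (Fin c → ℤ) × (Fin c → ℤ) :=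
    { toFun := fun x => (x.2, x.1 - x.2)
      invFun := fun x => (x.2 + x.1, x.1)
      left_inv := fun x => by simp
      right_inv := fun x => by simp }
  have h1 : Summable fun x : (Fin c → ℤ) × (Fin c → ℤ) => (g x.1 * β x.1) * (g x.2 * γ x.2) :=
    hβ.mul_of_nonneg hγ (fun m => mul_nonneg (hg.pos m).le (hβ0 m))
      fun m => mul_nonneg (hg.pos m).le (hγ0 m)
  refine (e.summable_iff.2 h1).of_nonneg_of_le (fun x => mul_nonneg (hg.pos _).le
    (mul_nonneg (hβ0 _) (hγ0 _))) fun x => ?_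
  change _ ≤ (g x.2 * β x.2) * (g (x.1 - x.2) * γ (x.1 - x.2))
  rw [mul_mul_mul_comm]
  refine mul_le_mul_of_nonneg_right ?_ (mul_nonneg (hβ0 _) (hγ0 _))
  simpa using hg.submul x.2 (x.1 - x.2)

/-- The locally nuclear operators form a right ideal for the operators with summable matrices. -/
theorem IsLocallyNuclear.mul [CompleteSpace X] (hg : IsAdmissibleWeight g)
    {A S : lp (fun _ : Fin c → ℤ => X) p →L[ℂ] lp (fun _ : Fin c → ℤ => X) p}
    (hA : IsLocallyNuclear g A) (hS : IsSummableMatrix g S) : IsLocallyNuclear g (A * S) := by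
  obtain ⟨b, β, hβ, hb, hbβ, hA⟩ := hA
  obtain ⟨d, γ, hγ, hdγ, hS⟩ := hS
  have hβ0 : ∀ m, 0 ≤ β m := fun m =>
    (norm_nonneg _).trans ((hb 0 m).norm_le_nuclearNorm.trans (hbβ 0 m))
  have hγ0 : ∀ m, 0 ≤ γ m := fun m => (norm_nonneg _).trans (hdγ 0 m)
  simp only [abs_of_nonneg (hβ0 _)] at hβ
  have hw := summable_weighted_convolution hg hβ0 hγ0 hβ hγ
  have hu : Summable fun x : (Fin c → ℤ) × (Fin c → ℤ) => β x.2 * γ (x.1 - x.2) :=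
    hw.of_nonneg_of_le (fun x => mul_nonneg (hβ0 _) (hγ0 _)) fun x =>
      le_mul_of_one_le_left (mul_nonneg (hβ0 _) (hγ0 _)) (hg.one_le _)
  have hnuc : ∀ k m n, nuclearNorm (b k n ∘L d (k - n) (m - n)) ≤ β n * γ (m - n) :=
    fun k m n => ((hb k n).nuclearNorm_comp_le _).trans
      (mul_le_mul (hbβ k n) (hdγ _ _) (norm_nonneg _) (hβ0 n))
  have hnorm : ∀ k m n, ‖b k n ∘L d (k - n) (m - n)‖ ≤ β n * γ (m - n) :=
    fun k m n => ((hb k n).comp _).norm_le_nuclearNorm.trans (hnuc k m n)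
  have hes : ∀ k m, Summable fun n => b k n ∘L d (k - n) (m - n) := fun k m =>
    Summable.of_norm_bounded (hu.prod_factor m) (hnorm k m)
  choose e he using hes
  have hea : ∀ k m v, HasSum (fun n => (b k n ∘L d (k - n) (m - n)) v) (e k m v) :=
    fun k m v => (he k m).clm_apply v
  refine ⟨e, fun m => ∑' n, β n * γ (m - n), ?_, fun k m => isNuclear_of_hasSum
    (fun n => (hb k n).comp _) (hnuc k m) (hu.prod_factor m) (hea k m),
    fun k m => nuclearNorm_le_of_hasSum (fun n => (hb k n).comp _) (hnuc k m) (hu.prod_factor m)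
      (hea k m), fun x k => ?_⟩
  · refine hw.prod.congr fun m => ?_
    rw [abs_of_nonneg (tsum_nonneg fun n => mul_nonneg (hβ0 _) (hγ0 _)), ← tsum_mul_left]
  · have hp0 : p ≠ 0 := (zero_lt_one.trans_le Fact.out).ne'
    obtain ⟨s, hs⟩ : Summable fun q : (Fin c → ℤ) × (Fin c → ℤ) =>
        (b k q.2 ∘L d (k - q.2) (q.1 - q.2)) (x (k - q.1)) := by
      refine Summable.of_norm_bounded (hu.mul_right ‖x‖) fun q => ?_
      refine ((b k q.2 ∘L d (k - q.2) (q.1 - q.2)).le_of_opNorm_le (hnorm k q.1 q.2) _).trans ?_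
      exact mul_le_mul_of_nonneg_left (lp.norm_apply_le_norm hp0 x _)
        (mul_nonneg (hβ0 _) (hγ0 _))
    have h1 : HasSum (fun m => e k m (x (k - m))) s :=
      hs.prod_fiberwise fun m => hea k m (x (k - m))
    let σ : (Fin c → ℤ) × (Fin c → ℤ) ≃ (Fin c → ℤ) × (Fin c → ℤ) :=
      { toFun := fun q => (q.2 + q.1, q.1)
        invFun := fun q => (q.2, q.1 - q.2)
        left_inv := fun q => by simp
        right_inv := fun q => by simp }
    have h2 : HasSum (fun q : (Fin c → ℤ) × (Fin c → ℤ) =>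
        b k q.1 (d (k - q.1) q.2 (x (k - q.1 - q.2)))) s := by
      refine (σ.hasSum_iff.2 hs).congr_fun fun q => ?_
      change _ = b k q.1 (d (k - q.1) (q.2 + q.1 - q.1) (x (k - (q.2 + q.1))))
      rw [add_sub_cancel_right, sub_sub, add_comm q.1]
    have h3 : HasSum (fun n => b k n (S x (k - n))) s :=
      h2.prod_fiberwise fun n => (b k n).hasSum (hS x (k - n))
    have h4 : A (S x) k = s := (hA (S x) k).unique h3
    change HasSum _ (A (S x) k)
    rwa [h4]

theorem isNuclear_one_of_isLocallyNuclear_one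
    (h : IsLocallyNuclear g (1 : lp (fun _ : Fin c → ℤ => X) p →L[ℂ]
      lp (fun _ : Fin c → ℤ => X) p)) : IsNuclear (1 : X →L[ℂ] X) := by
  obtain ⟨b, β, -, hb, -, h⟩ := h
  have h1 : b 0 0 = 1 := by
    ext v
    have h2 := h (lp.single p 0 v) 0
    have h3 := hasSum_single (f := fun m => b 0 m (lp.single (E := fun _ : Fin c → ℤ => X)
      p 0 v (0 - m))) 0 fun m hm => by
        rw [lp.single_apply, Pi.single_eq_of_ne (by simpa using hm), map_zero]
    have h4 := h3.unique h2
    simpa using h4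
  exact h1 ▸ hb 0 0

/-- The inverse of `λ + A` with `A` locally nuclear is `λ⁻¹ + A₁`, where
`A₁ = -λ⁻¹ A (λ + A)⁻¹` is locally nuclear. -/
theorem IsLocallyNuclear.inverse [CompleteSpace X] (hg : IsAdmissibleWeight g)
    (hX : ¬ FiniteDimensional ℂ X)
    {A Q : lp (fun _ : Fin c → ℤ => X) p →L[ℂ] lp (fun _ : Fin c → ℤ => X) p}
    (hA : IsLocallyNuclear g A) {z : ℂ} (h1 : (z • 1 + A) * Q = 1) (h2 : Q * (z • 1 + A) = 1) :
    z ≠ 0 ∧ IsLocallyNuclear g (A * (-z⁻¹ • Q)) := by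
  have hQ : IsSummableMatrix g Q :=
    ((isSummableMatrix_smul_one g z).add hA.isSummableMatrix).inverse hg h1 h2
  refine ⟨?_, hA.mul hg (hQ.smul _)⟩
  rintro rfl
  rw [zero_smul, zero_add] at h1
  exact hX (finiteDimensional_of_isNuclear_one
    (isNuclear_one_of_isLocallyNuclear_one (h1 ▸ hA.mul hg hQ)))

end LocallyNuclear

/-- A family of pairwise disjoint open subsets of the unit cube. -/
def smallCube (c n : ℕ) : Set (Fin c → ℝ) :=
  Set.univ.pi fun _ => Set.Ioo (1 / ((n : ℝ) + 2)) (1 / ((n : ℝ) + 1))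

theorem isOpen_smallCube (c n : ℕ) : IsOpen (smallCube c n) :=
  isOpen_set_pi Set.finite_univ fun _ _ => isOpen_Ioo

theorem smallCube_subset_unitCube (c n : ℕ) : smallCube c n ⊆ unitCube c := by
  refine Set.pi_mono fun i _ x hx => ⟨?_, hx.2.trans_le ?_⟩
  · exact le_trans (by positivity) hx.1.le
  · rw [div_le_one (by positivity)]
    linarith [(Nat.cast_nonneg n : (0 : ℝ) ≤ n)]

theorem smallCube_nonempty (c n : ℕ) : (smallCube c n).Nonempty := by
  have h : 1 / ((n : ℝ) + 2) < 1 / ((n : ℝ) + 1) :=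
    one_div_lt_one_div_of_lt (by positivity) (by linarith)
  obtain ⟨x, hx⟩ := exists_between h
  exact ⟨fun _ => x, fun _ _ => hx⟩

theorem disjoint_smallCube {c : ℕ} (hc : 0 < c) {m n : ℕ} (hmn : m ≠ n) :
    Disjoint (smallCube c m) (smallCube c n) := by
  have key : ∀ {m n : ℕ}, m < n → Disjoint (smallCube c m) (smallCube c n) := by
    intro m n h
    refine Set.disjoint_left.2 fun x hm hn => ?_
    have h1 := (hm ⟨0, hc⟩ trivial).1
    have h2 := (hn ⟨0, hc⟩ trivial).2
    have h3 : (m : ℝ) + 1 ≤ n := by exact_mod_cast h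
    have h4 : 1 / ((n : ℝ) + 1) ≤ 1 / ((m : ℝ) + 2) :=
      one_div_le_one_div_of_le (by positivity) (by linarith)
    linarith
  rcases hmn.lt_or_gt with h | h
  · exact key h
  · exact (key h).symm

theorem cubeMeasure_smallCube_ne_zero (c n : ℕ) : cubeMeasure c (smallCube c n) ≠ 0 := by
  rw [Measure.restrict_eq_self _ (smallCube_subset_unitCube c n)]
  exact (isOpen_smallCube c n).measure_ne_zero _ (smallCube_nonempty c n)

theorem cubeMeasure_smallCube_ne_top (c n : ℕ) : cubeMeasure c (smallCube c n) ≠ ∞ := by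
  rw [Measure.restrict_eq_self _ (smallCube_subset_unitCube c n)]
  refine ((Bornology.IsBounded.pi fun _ => Metric.isBounded_Ioo _ _).measure_lt_top).ne

theorem not_finiteDimensional_LpCube {c : ℕ} (hc : 0 < c) (p : ℝ≥0∞) [Fact (1 ≤ p)] :
    ¬ FiniteDimensional ℂ (LpCube c p) := by
  intro hfin
  let f : ℕ → LpCube c p := fun n =>
    indicatorConstLp p (isOpen_smallCube c n).measurableSet (cubeMeasure_smallCube_ne_top c n) 1
  suffices h : LinearIndependent ℂ f by
    have := h.finite
    exact not_finite ℕ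
  rw [linearIndependent_iff']
  intro s z hz j hj
  let R := LpToLpRestrictCLM (Fin c → ℝ) ℂ ℂ (cubeMeasure c) p (smallCube c j)
  have hR0 : ∀ i, i ≠ j → R (f i) = 0 := by
    intro i hij
    refine Lp.ext ?_
    filter_upwards [LpToLpRestrictCLM_coeFn ℂ (smallCube c j) (f i),
      ae_restrict_of_ae (indicatorConstLp_coeFn_notMem (p := p)
        (hs := (isOpen_smallCube c i).measurableSet) (hμs := cubeMeasure_smallCube_ne_top c i)
        (c := (1 : ℂ))), ae_restrict_mem (isOpen_smallCube c j).measurableSet,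
      Lp.coeFn_zero ℂ p ((cubeMeasure c).restrict (smallCube c j))] with t h1 h2 h3 h4
    rw [h1, h4]
    exact h2 (Set.disjoint_right.1 (disjoint_smallCube hc hij) h3)
  have hR1 : R (f j) ≠ 0 := by
    intro h0
    have hfalse : ∀ᵐ _ ∂((cubeMeasure c).restrict (smallCube c j)), False := by
      filter_upwards [LpToLpRestrictCLM_coeFn ℂ (smallCube c j) (f j),
        ae_restrict_of_ae (indicatorConstLp_coeFn_mem (p := p)
          (hs := (isOpen_smallCube c j).measurableSet) (hμs := cubeMeasure_smallCube_ne_top c j)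
          (c := (1 : ℂ))), ae_restrict_mem (isOpen_smallCube c j).measurableSet,
        Lp.coeFn_zero ℂ p ((cubeMeasure c).restrict (smallCube c j))] with t h1 h2 h3 h4
      have h5 : R (f j) t = 0 := by rw [h0, h4]; rfl
      have h6 : R (f j) t = 1 := h1.trans (h2 h3)
      exact one_ne_zero (h6.symm.trans h5)
    rw [Filter.eventually_false_iff_eq_bot, ae_eq_bot, Measure.restrict_eq_zero] at hfalse
    exact cubeMeasure_smallCube_ne_zero c j hfalse
  have h := congrArg R hz
  rw [map_sum, map_zero, Finset.sum_eq_single_of_mem j hj fun i _ hij => by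
    rw [map_smul, hR0 i hij, smul_zero], map_smul] at h
  exact (smul_eq_zero.1 h).resolve_right hR1

section Transfer

variable {c : ℕ} {p : ℝ≥0∞} [Fact (1 ≤ p)]

/-- The operator `φ A φ⁻¹` on `l_p(ℤ^c, L_p([0,1)^c, ℂ))`. -/
noncomputable def cubeConj (A : LpSpace c p →L[ℂ] LpSpace c p) :
    SeqLpCube c p →L[ℂ] SeqLpCube c p :=
  (cubeEquiv c p : LpSpace c p →L[ℂ] SeqLpCube c p) ∘L A ∘L
    ((cubeEquiv c p).symm : SeqLpCube c p →L[ℂ] LpSpace c p)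

theorem cubeConj_apply (A : LpSpace c p →L[ℂ] LpSpace c p) (x : SeqLpCube c p) :
    cubeConj A x = cubeEquiv c p (A ((cubeEquiv c p).symm x)) :=
  rfl

theorem cubeConj_mul (A B : LpSpace c p →L[ℂ] LpSpace c p) :
    cubeConj (A * B) = cubeConj A * cubeConj B := by
  refine ContinuousLinearMap.ext fun x => ?_
  rw [mul_apply_eq_comp, cubeConj_apply, cubeConj_apply, cubeConj_apply,
    LinearIsometryEquiv.symm_apply_apply]
  rfl

theorem cubeConj_add (A B : LpSpace c p →L[ℂ] LpSpace c p) :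
    cubeConj (A + B) = cubeConj A + cubeConj B :=
  ContinuousLinearMap.ext fun _ => map_add (cubeEquiv c p) _ _

theorem cubeConj_smul (z : ℂ) (A : LpSpace c p →L[ℂ] LpSpace c p) :
    cubeConj (z • A) = z • cubeConj A :=
  ContinuousLinearMap.ext fun _ => map_smul (cubeEquiv c p) _ _

theorem cubeConj_one : cubeConj (1 : LpSpace c p →L[ℂ] LpSpace c p) = 1 :=
  ContinuousLinearMap.ext fun x => LinearIsometryEquiv.apply_symm_apply (cubeEquiv c p) x

theorem cubeConj_zero : cubeConj (0 : LpSpace c p →L[ℂ] LpSpace c p) = 0 :=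
  ContinuousLinearMap.ext fun _ => map_zero (cubeEquiv c p)

theorem isLocallyNuclearLp_iff {g : (Fin c → ℤ) → ℝ} {A : LpSpace c p →L[ℂ] LpSpace c p} :
    IsLocallyNuclearLp g A ↔ IsLocallyNuclear g (cubeConj A) :=
  Iff.rfl

variable {g : (Fin c → ℤ) → ℝ}

theorem isLocallyNuclearLp_zero (g : (Fin c → ℤ) → ℝ) :
    IsLocallyNuclearLp g (0 : LpSpace c p →L[ℂ] LpSpace c p) := by
  rw [isLocallyNuclearLp_iff, cubeConj_zero]
  exact isLocallyNuclear_zero g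

theorem IsLocallyNuclearLp.add (hg : IsAdmissibleWeight g)
    {A B : LpSpace c p →L[ℂ] LpSpace c p} (hA : IsLocallyNuclearLp g A)
    (hB : IsLocallyNuclearLp g B) : IsLocallyNuclearLp g (A + B) := by
  rw [isLocallyNuclearLp_iff, cubeConj_add]
  exact IsLocallyNuclear.add hg hA hB

theorem IsLocallyNuclearLp.mul (hg : IsAdmissibleWeight g)
    {A B : LpSpace c p →L[ℂ] LpSpace c p} (hA : IsLocallyNuclearLp g A)
    (hB : IsLocallyNuclearLp g B) : IsLocallyNuclearLp g (A * B) := by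
  rw [isLocallyNuclearLp_iff, cubeConj_mul]
  exact IsLocallyNuclear.mul hg hA (IsLocallyNuclear.isSummableMatrix hB)

theorem IsLocallyNuclearLp.smul (hg : IsAdmissibleWeight g)
    {A : LpSpace c p →L[ℂ] LpSpace c p} (hA : IsLocallyNuclearLp g A) (z : ℂ) :
    IsLocallyNuclearLp g (z • A) := by
  have h : z • A = A * (z • 1) := by rw [mul_smul_comm, mul_one]
  rw [isLocallyNuclearLp_iff, h, cubeConj_mul, cubeConj_smul, cubeConj_one]
  exact IsLocallyNuclear.mul hg hA (isSummableMatrix_smul_one g z)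

theorem IsLocallyNuclearLp.inverse (hc : 0 < c) (hg : IsAdmissibleWeight g)
    {A Q : LpSpace c p →L[ℂ] LpSpace c p} (hA : IsLocallyNuclearLp g A) {z : ℂ}
    (h1 : (z • (1 : LpSpace c p →L[ℂ] LpSpace c p) + A) * Q = 1)
    (h2 : Q * (z • (1 : LpSpace c p →L[ℂ] LpSpace c p) + A) = 1) :
    z ≠ 0 ∧ ∃ A₁ : LpSpace c p →L[ℂ] LpSpace c p, IsLocallyNuclearLp g A₁ ∧
      Q = z⁻¹ • (1 : LpSpace c p →L[ℂ] LpSpace c p) + A₁ := by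
  have h1' : (z • 1 + cubeConj A) * cubeConj Q = 1 := by
    rw [← cubeConj_one, ← cubeConj_smul, ← cubeConj_add, ← cubeConj_mul, h1]
  have h2' : cubeConj Q * (z • 1 + cubeConj A) = 1 := by
    rw [← cubeConj_one, ← cubeConj_smul, ← cubeConj_add, ← cubeConj_mul, h2]
  obtain ⟨hz, hN⟩ := IsLocallyNuclear.inverse hg (not_finiteDimensional_LpCube hc p)
    (isLocallyNuclearLp_iff.1 hA) h1' h2'
  refine ⟨hz, A * (-z⁻¹ • Q), ?_, ?_⟩
  · rw [isLocallyNuclearLp_iff, cubeConj_mul, cubeConj_smul]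
    exact hN
  · have h3 : z • Q + A * Q = 1 := by rw [← h1, add_mul, smul_mul_assoc, one_mul]
    rw [← h3, mul_smul_comm, neg_smul, smul_add, inv_smul_smul₀ hz, add_neg_cancel_right]

/-- The algebra obtained from the locally nuclear operators by adjoining the unit. -/
noncomputable def locallyNuclearSubalgebra (p : ℝ≥0∞) [Fact (1 ≤ p)]
    (hg : IsAdmissibleWeight g) : Subalgebra ℂ (LpSpace c p →L[ℂ] LpSpace c p) where
  carrier := adjoinUnit {A : LpSpace c p →L[ℂ] LpSpace c p | IsLocallyNuclearLp g A}
  mul_mem' := by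
    rintro _ _ ⟨α, A, hA, rfl⟩ ⟨β, B, hB, rfl⟩
    refine ⟨α * β, (β • A + α • B) + A * B,
      ((hA.smul hg β).add hg (hB.smul hg α)).add hg (hA.mul hg hB), ?_⟩
    simp only [add_mul, mul_add, smul_mul_assoc, mul_smul_comm, one_mul, mul_one, smul_add,
      smul_smul, mul_comm β α]
    abel
  add_mem' := by
    rintro _ _ ⟨α, A, hA, rfl⟩ ⟨β, B, hB, rfl⟩
    refine ⟨α + β, A + B, hA.add hg hB, ?_⟩
    rw [add_smul]
    abel
  algebraMap_mem' z := ⟨z, 0, isLocallyNuclearLp_zero g, by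
    rw [Algebra.algebraMap_eq_smul_one, add_zero]⟩

end Transfer

theorem locally_nuclear_Lp_inverse_closed (c : ℕ) (hc : 0 < c) (p : ℝ≥0∞) [Fact (1 ≤ p)]
    (g : (Fin c → ℤ) → ℝ) (hg : IsAdmissibleWeight g) :
    (∀ (A : LpSpace c p →L[ℂ] LpSpace c p), IsLocallyNuclearLp g A →
      ∀ (lam : ℂ) (Q : LpSpace c p →L[ℂ] LpSpace c p),
        (lam • (1 : LpSpace c p →L[ℂ] LpSpace c p) + A) * Q = 1 →
        Q * (lam • (1 : LpSpace c p →L[ℂ] LpSpace c p) + A) = 1 →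
        lam ≠ 0 ∧ ∃ A₁ : LpSpace c p →L[ℂ] LpSpace c p, IsLocallyNuclearLp g A₁ ∧
          Q = lam⁻¹ • (1 : LpSpace c p →L[ℂ] LpSpace c p) + A₁) ∧
    IsFullSubalgebra
      (adjoinUnit {A : LpSpace c p →L[ℂ] LpSpace c p | IsLocallyNuclearLp g A}) := by
  refine ⟨fun A hA lam Q h1 h2 => hA.inverse hc hg h1 h2,
    locallyNuclearSubalgebra p hg, rfl, ?_⟩
  rintro _ ⟨α, A, hA, rfl⟩ Q h1 h2
  obtain ⟨-, A₁, hA₁, hQ⟩ := IsLocallyNuclearLp.inverse hc hg hA h1 h2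
  exact ⟨α⁻¹, A₁, hA₁, hQ⟩
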